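/- Let I₀ ⊂ ℝ be an interval, let f ∈ C³(I₀) with f''(x) ≠ 0 for (Lebesgue) almost all x ∈ I₀, and let ψ be an approximating function with ∑_{h=1}^∞ ψ(h)² = ∞. Then for almost all x ∈ I₀ the point (x, f(x)) is simultaneously ψ-approximable, i.e. (x, f(x)) ∈ S₂(ψ). -/

import Mathlib

open MeasureTheory Filter

/-- The distance from a real number to the nearest integer. -/
noncomputable def distNearestInt (x : ℝ) : ℝ := |x - round x|

/-- An approximating function: a decreasing function `ℝ₊ → ℝ₊` taking positive values. -/
def IsApproxFun (ψ : ℝ → ℝ) : Prop :=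
  (∀ x y : ℝ, 0 < x → x ≤ y → ψ y ≤ ψ x) ∧ ∀ x : ℝ, 0 < x → 0 < ψ x

/-- The set `S₂(ψ)` of simultaneously `ψ`-approximable points of the plane. -/
def SimApprox2 (ψ : ℝ → ℝ) : Set (ℝ × ℝ) :=
  {y : ℝ × ℝ |
    {q : ℕ | 0 < q ∧
      max (distNearestInt (q * y.1)) (distNearestInt (q * y.2)) < ψ q}.Infinite}

/-- A finite-measure set of reals has a point with little mass to its left. -/
lemma exists_mem_measureReal_inter_Ici_ge {E : Set ℝ} {c d l : ℝ} (hE : E ⊆ Set.Ico c d)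
    (hne : E.Nonempty) (hl : 0 < l) :
    ∃ y ∈ E, volume.real E - 2 * l ≤ volume.real (E ∩ Set.Ici (y + l)) := by
  have hbdd : BddBelow E := ⟨c, fun x hx => (hE hx).1⟩
  obtain ⟨y, hy, hyl⟩ := exists_lt_of_csInf_lt hne (lt_add_of_pos_right (sInf E) hl)
  refine ⟨y, hy, ?_⟩
  have hsub : E ⊆ (E ∩ Set.Ici (y + l)) ∪ Set.Ico (sInf E) (sInf E + 2 * l) := by
    intro x hx
    by_cases h : y + l ≤ x
    · exact Or.inl ⟨hx, h⟩
    · exact Or.inr ⟨csInf_le hbdd hx, by linarith⟩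
  have hfin : volume ((E ∩ Set.Ici (y + l)) ∪ Set.Ico (sInf E) (sInf E + 2 * l)) ≠ ⊤ := by
    refine ((measure_union_le _ _).trans_lt (ENNReal.add_lt_top.2 ⟨?_, ?_⟩)).ne
    · exact (measure_mono (Set.inter_subset_left.trans hE)).trans_lt (by simp)
    · rw [Real.volume_Ico]; exact ENNReal.ofReal_lt_top
  have h1 := measureReal_mono hsub hfin
  have h2 := measureReal_union_le (μ := volume) (E ∩ Set.Ici (y + l))
    (Set.Ico (sInf E) (sInf E + 2 * l))
  have h3 : volume.real (Set.Ico (sInf E) (sInf E + 2 * l)) = 2 * l := by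
    rw [Real.volume_real_Ico]; rw [max_eq_left] <;> linarith
  linarith

lemma exists_four_separated {E : Set ℝ} {c d l : ℝ} (hE : E ⊆ Set.Ico c d) (hl : 0 < l)
    (hm : 6 * l < volume.real E) :
    ∃ y₁ ∈ E, ∃ y₂ ∈ E, ∃ y₃ ∈ E, ∃ y₄ ∈ E, y₁ + l ≤ y₂ ∧ y₂ + l ≤ y₃ ∧ y₃ + l ≤ y₄ := by
  have ne : ∀ {S : Set ℝ}, 0 < volume.real S → S.Nonempty := by
    intro S hS
    by_contra h
    rw [Set.not_nonempty_iff_eq_empty] at h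
    simp [h] at hS
  obtain ⟨y₁, h₁, m₁⟩ := exists_mem_measureReal_inter_Ici_ge hE (ne (by linarith)) hl
  obtain ⟨y₂, h₂, m₂⟩ := exists_mem_measureReal_inter_Ici_ge (E := E ∩ Set.Ici (y₁ + l))
    (Set.inter_subset_left.trans hE) (ne (by linarith)) hl
  obtain ⟨y₃, h₃, m₃⟩ := exists_mem_measureReal_inter_Ici_ge
    (E := E ∩ Set.Ici (y₁ + l) ∩ Set.Ici (y₂ + l))
    (Set.inter_subset_left.trans (Set.inter_subset_left.trans hE)) (ne (by linarith)) hl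
  obtain ⟨y₄, h₄⟩ := ne (show 0 < volume.real
    (E ∩ Set.Ici (y₁ + l) ∩ Set.Ici (y₂ + l) ∩ Set.Ici (y₃ + l)) by linarith)
  exact ⟨y₁, h₁, y₂, h₂.1, y₃, h₃.1.1, y₄, h₄.1.1.1, h₂.2, h₃.2, h₄.2⟩

/-- The weighted sup norm of the triple `(φ x, lam x, k)`. -/
noncomputable def nrm (A B D : ℝ) (φ lam : ℝ → ℝ) (k x : ℝ) : ℝ :=
  max (|φ x| / A) (max (|lam x| / B) (|k| / D))

lemma nrm_lt_iff {A B D : ℝ} (hA : 0 < A) (hB : 0 < B) (hD : 0 < D) {φ lam : ℝ → ℝ} {k x ε : ℝ} :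
    nrm A B D φ lam k x < ε ↔ |φ x| < ε * A ∧ |lam x| < ε * B ∧ |k| < ε * D := by
  simp only [nrm, max_lt_iff, div_lt_iff₀ hA, div_lt_iff₀ hB, div_lt_iff₀ hD]

lemma nrm_le_iff {A B D : ℝ} (hA : 0 < A) (hB : 0 < B) (hD : 0 < D) {φ lam : ℝ → ℝ} {k x ε : ℝ} :
    nrm A B D φ lam k x ≤ ε ↔ |φ x| ≤ ε * A ∧ |lam x| ≤ ε * B ∧ |k| ≤ ε * D := by
  simp only [nrm, max_le_iff, div_le_iff₀ hA, div_le_iff₀ hB, div_le_iff₀ hD]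

/-- A function on `[u, v]` whose sublevel sets inside any subinterval are controlled by its
supremum there. -/
structure IsGood (C u v : ℝ) (N : ℝ → ℝ) : Prop where
  cont : ContinuousOn N (Set.Icc u v)
  bound : ∀ c d ε ρ : ℝ, u ≤ c → c < d → d ≤ v → 0 < ε → 0 < ρ → (∃ z ∈ Set.Ico c d, ρ ≤ N z) →
    ρ * volume.real {x ∈ Set.Ico c d | N x < ε} ^ 2 ≤ C * ε * (d - c) ^ 2

/-- The pair `(φ, lam)` behaves like (quadratic polynomial, its derivative), with leading
coefficient comparable to `k`. -/
structure QuadraticLike (φ lam h : ℝ → ℝ) (k u v K : ℝ) : Prop where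
  deriv : ∀ x ∈ Set.Icc u v, HasDerivAt φ (h x * lam x) x
  lo : ∀ x ∈ Set.Icc u v, K⁻¹ ≤ |h x|
  hi : ∀ x ∈ Set.Icc u v, |h x| ≤ K
  lam_lo : ∀ x ∈ Set.Icc u v, ∀ y ∈ Set.Icc u v, K⁻¹ * |k| * |x - y| ≤ |lam x - lam y|
  lam_hi : ∀ x ∈ Set.Icc u v, ∀ y ∈ Set.Icc u v, |lam x - lam y| ≤ K * |k| * |x - y|

lemma exists_mul_sub_of_hasDerivAt {φ φ' : ℝ → ℝ} {u v x y : ℝ}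
    (h : ∀ z ∈ Set.Icc u v, HasDerivAt φ (φ' z) z) (hx : x ∈ Set.Icc u v) (hy : y ∈ Set.Icc u v)
    (hxy : x < y) : ∃ z ∈ Set.Ioo x y, z ∈ Set.Icc u v ∧ φ y - φ x = φ' z * (y - x) := by
  have hs : Set.Icc x y ⊆ Set.Icc u v := Set.Icc_subset_Icc hx.1 hy.2
  obtain ⟨z, hz, hzz⟩ := exists_hasDerivAt_eq_slope φ φ' hxy
    (fun z hz => (h z (hs hz)).continuousAt.continuousWithinAt)
    (fun z hz => h z (hs ⟨hz.1.le, hz.2.le⟩))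
  refine ⟨z, hz, hs ⟨hz.1.le, hz.2.le⟩, ?_⟩
  rw [hzz, div_mul_cancel₀]
  linarith

/-- Smallness at four separated points forces smallness on the whole interval. -/
lemma QuadraticLike.nrm_le_of_four {φ lam h : ℝ → ℝ} {k u v K : ℝ}
    (H : QuadraticLike φ lam h k u v K) (hK : 1 ≤ K) {A B D : ℝ} (hA : 0 < A) (hB : 0 < B)
    (hD : 0 < D) {c d ε l : ℝ} (hc : u ≤ c) (hd : d ≤ v) (hε : 0 < ε) (hl : 0 < l) {y : Fin 4 → ℝ}
    (hy : ∀ i, y i ∈ Set.Ico c d) (h01 : y 0 + l ≤ y 1) (h12 : y 1 + l ≤ y 2) (h23 : y 2 + l ≤ y 3)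
    (hN : ∀ i, nrm A B D φ lam k (y i) < ε) {x : ℝ} (hx : x ∈ Set.Ico c d) :
    nrm A B D φ lam k x ≤ 7 * K ^ 4 * ((d - c) / l) ^ 2 * ε := by
  simp only [nrm_lt_iff hA hB hD] at hN
  rw [nrm_le_iff hA hB hD]
  have mem : ∀ {z}, z ∈ Set.Ico c d → z ∈ Set.Icc u v := fun hz => ⟨hc.trans hz.1, hz.2.le.trans hd⟩
  have dist_le : ∀ {z w}, z ∈ Set.Ico c d → w ∈ Set.Ico c d → |z - w| ≤ d - c := by
    intro z w hz hw
    rw [abs_le]; constructor <;> linarith [hz.1, hz.2, hw.1, hw.2]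
  have hK0 : 0 < K := by linarith
  obtain ⟨t, ht⟩ : ∃ t, t = (d - c) / l := ⟨_, rfl⟩
  have hdc : d - c = t * l := by rw [ht]; field_simp
  have ht1 : 1 ≤ t := by
    rw [ht, le_div_iff₀ hl]; linarith [(hy 0).1, (hy 3).2]
  rw [← ht]
  have hK2 : 1 ≤ K ^ 2 := one_le_pow₀ hK
  have hK4 : K ^ 2 ≤ K ^ 4 := pow_le_pow_right₀ hK (by norm_num)
  have ht2 : t ≤ t ^ 2 := by nlinarith
  have hKt : K ^ 2 * t ≤ K ^ 4 * t ^ 2 := mul_le_mul hK4 ht2 (by linarith) (by positivity)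
  have h1Kt : 1 ≤ K ^ 4 * t ^ 2 := by nlinarith
  have slope : ∀ z w η, z ∈ Set.Ico c d → w ∈ Set.Ico c d → l ≤ w - z → |lam z| ≤ η → |lam w| ≤ η →
      |k| * l ≤ 2 * K * η := by
    intro z w η hz hw hzw hlz hlw
    have h1 := H.lam_lo w (mem hw) z (mem hz)
    have h2 := abs_sub (lam w) (lam z)
    have h3 : K⁻¹ * |k| * |w - z| ≤ 2 * η := by linarith
    have h4 : |k| * |w - z| ≤ 2 * K * η := by
      have := mul_le_mul_of_nonneg_left h3 hK0.le
      calc |k| * |w - z| = K * (K⁻¹ * |k| * |w - z|) := by field_simp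
        _ ≤ K * (2 * η) := this
        _ = _ := by ring
    exact (mul_le_mul_of_nonneg_left (hzw.trans (le_abs_self _)) (abs_nonneg k)).trans h4
  have far : ∀ z w, z ∈ Set.Ico c d → w ∈ Set.Ico c d → |lam w| ≤ |lam z| + K * (|k| * l) * t := by
    intro z w hz hw
    have h1 := H.lam_hi w (mem hw) z (mem hz)
    have h2 := abs_sub_abs_le_abs_sub (lam w) (lam z)
    have h3 : K * |k| * |w - z| ≤ K * |k| * (d - c) :=
      mul_le_mul_of_nonneg_left (dist_le hw hz) (by positivity)
    rw [hdc] at h3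
    linarith [h3]
  refine ⟨?_, ?_, ?_⟩
  · have crit : ∀ i j, y i + l ≤ y j →
      ∃ z ∈ Set.Ioo (y i) (y j), |lam z| * l ≤ 2 * K * (ε * A) := by
      intro i j hij
      obtain ⟨z, hz, hzm, hzz⟩ := exists_mul_sub_of_hasDerivAt H.deriv (mem (hy i)) (mem (hy j))
        (by linarith)
      refine ⟨z, hz, ?_⟩
      have h1 := abs_sub (φ (y j)) (φ (y i))
      have h2 : |h z| * |lam z| * |y j - y i| ≤ 2 * (ε * A) := by
        rw [← abs_mul, ← abs_mul, ← hzz]; linarith [(hN i).1, (hN j).1]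
      have h3 : K⁻¹ * (|lam z| * l) ≤ |h z| * |lam z| * |y j - y i| := by
        rw [mul_assoc]
        exact mul_le_mul (H.lo z hzm) (mul_le_mul_of_nonneg_left
          ((by linarith : l ≤ y j - y i).trans (le_abs_self _)) (abs_nonneg _)) (by positivity)
          (abs_nonneg _)
      calc |lam z| * l = K * (K⁻¹ * (|lam z| * l)) := by field_simp
        _ ≤ K * (2 * (ε * A)) := mul_le_mul_of_nonneg_left (h3.trans h2) hK0.le
        _ = _ := by ring
    obtain ⟨z, hz, hzl⟩ := crit 0 1 h01
    obtain ⟨w, hw, hwl⟩ := crit 2 3 h23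
    have hz' : z ∈ Set.Ico c d := ⟨(hy 0).1.trans hz.1.le, hz.2.trans (hy 1).2⟩
    have hw' : w ∈ Set.Ico c d := ⟨(hy 2).1.trans hw.1.le, hw.2.trans (hy 3).2⟩
    have hk := slope z w (2 * K * (ε * A) / l) hz' hw' (by linarith [hz.2, hw.1])
      (by rwa [le_div_iff₀ hl]) (by rwa [le_div_iff₀ hl])
    have hlam : ∀ p ∈ Set.Ico c d, |lam p| * l ≤ (2 * K + 4 * K ^ 3 * t) * (ε * A) := by
      intro p hp
      have h1 := far z p hz' hp
      have h2 : |k| * l * l ≤ 4 * K ^ 2 * (ε * A) := by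
        calc |k| * l * l ≤ 2 * K * (2 * K * (ε * A) / l) * l := by gcongr
          _ = _ := by field_simp; ring
      calc |lam p| * l ≤ (|lam z| + K * (|k| * l) * t) * l := by gcongr
        _ = |lam z| * l + K * t * (|k| * l * l) := by ring
        _ ≤ 2 * K * (ε * A) + K * t * (4 * K ^ 2 * (ε * A)) := by gcongr
        _ = _ := by ring
    have hvar : |φ x - φ (y 0)| ≤ K * (2 * K + 4 * K ^ 3 * t) * t * (ε * A) := by
      have key : ∀ p q, p ∈ Set.Ico c d → q ∈ Set.Ico c d → p < q →
          |φ q - φ p| ≤ K * (2 * K + 4 * K ^ 3 * t) * t * (ε * A) := by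
        intro p q hp hq hpq
        obtain ⟨s, hs, hsm, hss⟩ := exists_mul_sub_of_hasDerivAt H.deriv (mem hp) (mem hq) hpq
        have hs' : s ∈ Set.Ico c d := ⟨hp.1.trans hs.1.le, hs.2.trans hq.2⟩
        rw [hss, abs_mul, abs_mul]
        have h1 := dist_le hq hp
        rw [hdc] at h1
        calc |h s| * |lam s| * |q - p| ≤ K * |lam s| * (t * l) := by
              gcongr
              exact H.hi s hsm
          _ = K * t * (|lam s| * l) := by ring
          _ ≤ K * t * ((2 * K + 4 * K ^ 3 * t) * (ε * A)) := by
              exact mul_le_mul_of_nonneg_left (hlam s hs') (by positivity)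
          _ = _ := by ring
      rcases lt_trichotomy x (y 0) with hlt | heq | hgt
      · rw [abs_sub_comm]; exact key _ _ hx (hy 0) hlt
      · rw [heq, sub_self, abs_zero]; positivity
      · exact key _ _ (hy 0) hx hgt
    have h1 := abs_sub_abs_le_abs_sub (φ x) (φ (y 0))
    have h2 : |φ x| ≤ (1 + K * (2 * K + 4 * K ^ 3 * t) * t) * (ε * A) := by
      linarith [(hN 0).1]
    refine h2.trans ?_
    rw [mul_assoc _ ε A]
    gcongr
    nlinarith
  · have hk := slope (y 0) (y 1) (ε * B) (hy 0) (hy 1) (by linarith) (hN 0).2.1.le (hN 1).2.1.le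
    have h1 := far (y 0) x (hy 0) hx
    have h2 : K * (|k| * l) * t ≤ K * (2 * K * (ε * B)) * t := by gcongr
    have h3 : |lam x| ≤ (1 + 2 * (K ^ 2 * t)) * (ε * B) := by linarith [(hN 0).2.1]
    refine h3.trans ?_
    rw [mul_assoc _ ε B]
    gcongr
    nlinarith
  · refine (hN 0).2.2.le.trans ?_
    rw [mul_assoc _ ε D]
    have : 0 < ε * D := by positivity
    nlinarith

lemma QuadraticLike.isGood {φ lam h : ℝ → ℝ} {k u v K : ℝ}
    (H : QuadraticLike φ lam h k u v K) (hK : 1 ≤ K) {A B D : ℝ} (hA : 0 < A) (hB : 0 < B)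
    (hD : 0 < D) : IsGood (343 * K ^ 4) u v (nrm A B D φ lam k) := by
  constructor
  · have h1 : ContinuousOn φ (Set.Icc u v) :=
      fun x hx => (H.deriv x hx).continuousAt.continuousWithinAt
    have h2 : ContinuousOn lam (Set.Icc u v) := by
      have : LipschitzOnWith (K * |k|).toNNReal lam (Set.Icc u v) := by
        refine LipschitzOnWith.of_dist_le_mul fun x hx y hy => ?_
        rw [Real.coe_toNNReal _ (by positivity), Real.dist_eq, Real.dist_eq]
        exact H.lam_hi x hx y hy
      exact this.continuousOn
    unfold nrm
    fun_prop
  · intro c d ε ρ hc hcd hd hε hρ ⟨z, hz, hzρ⟩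
    set E := {x ∈ Set.Ico c d | nrm A B D φ lam k x < ε} with hEdef
    rcases (measureReal_nonneg (μ := volume) (s := E)).eq_or_lt with h0 | hpos
    · rw [← h0]
      simp only [ne_eq, OfNat.ofNat_ne_zero, not_false_eq_true, zero_pow, mul_zero]
      positivity
    · obtain ⟨y₁, h₁, y₂, h₂, y₃, h₃, y₄, h₄, h12, h23, h34⟩ := exists_four_separated
        (E := E) (c := c) (d := d) (l := volume.real E / 7) (fun x hx => hx.1)
        (by positivity) (by linarith)
      have key := H.nrm_le_of_four hK hA hB hD hc hd hε (l := volume.real E / 7) (by positivity)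
        (y := ![y₁, y₂, y₃, y₄]) (by
          intro i
          fin_cases i <;>
            simp [h₁.1.1, h₁.1.2, h₂.1.1, h₂.1.2, h₃.1.1, h₃.1.2, h₄.1.1, h₄.1.2])
        h12 h23 h34 (by intro i; fin_cases i <;> simp [h₁.2, h₂.2, h₃.2, h₄.2]) hz
      have h5 := hzρ.trans key
      calc ρ * volume.real E ^ 2 ≤
          (7 * K ^ 4 * ((d - c) / (volume.real E / 7)) ^ 2 * ε) * volume.real E ^ 2 := by gcongr
        _ = _ := by field_simp; ring

/-- `x` lies in an interval satisfying `P` obtained from `[c, d)` by at most `n` bisections. -/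
def BisectHit (P : ℝ → ℝ → Prop) : ℕ → ℝ → ℝ → ℝ → Prop
  | 0, c, d, x => x ∈ Set.Ico c d ∧ P c d
  | n + 1, c, d, x => (x ∈ Set.Ico c d ∧ P c d) ∨ BisectHit P n c ((c + d) / 2) x ∨
      BisectHit P n ((c + d) / 2) d x

lemma BisectHit.succ {P : ℝ → ℝ → Prop} {n : ℕ} {c d x : ℝ} (h : BisectHit P n c d x) :
    BisectHit P (n + 1) c d x := by
  induction n generalizing c d with
  | zero => exact Or.inl h
  | succ n ih =>
    rcases h with h | h | h
    · exact Or.inl h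
    · exact Or.inr (Or.inl (ih h))
    · exact Or.inr (Or.inr (ih h))

lemma volume_inter_bisectHit_le {P : ℝ → ℝ → Prop} {B : Set ℝ} {u v η : ℝ} (hη : 0 ≤ η)
    (hP : ∀ c d, u ≤ c → c < d → d ≤ v → P c d →
      volume (B ∩ Set.Ico c d) ≤ ENNReal.ofReal (η * (d - c)))
    (n : ℕ) {c d : ℝ} (hc : u ≤ c) (hcd : c < d) (hd : d ≤ v) :
    volume (B ∩ {x | BisectHit P n c d x}) ≤ ENNReal.ofReal (η * (d - c)) := by
  induction n generalizing c d with
  | zero =>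
    by_cases h : P c d
    · exact (measure_mono (t := B ∩ Set.Ico c d) fun x hx => ⟨hx.1, hx.2.1⟩).trans
        (hP c d hc hcd hd h)
    · have : B ∩ {x | BisectHit P 0 c d x} = ∅ := by
        ext x; simp [BisectHit, h]
      simp [this]
  | succ n ih =>
    have sub : ∀ (n : ℕ) {c d x : ℝ}, c < d → BisectHit P n c d x → x ∈ Set.Ico c d := by
      intro n
      induction n with
      | zero => exact fun _ h => h.1
      | succ n ih =>
        intro c d x hcd h
        rcases h with h | h | h
        · exact h.1
        · have := ih (by linarith) h; exact ⟨this.1, by linarith [this.2]⟩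
        · have := ih (by linarith) h; exact ⟨by linarith [this.1], this.2⟩
    by_cases h : P c d
    · exact (measure_mono (t := B ∩ Set.Ico c d) fun x hx => ⟨hx.1, sub _ hcd hx.2⟩).trans
        (hP c d hc hcd hd h)
    · have h1 := ih (c := c) (d := (c + d) / 2) hc (by linarith) (by linarith)
      have h2 := ih (c := (c + d) / 2) (d := d) (by linarith) (by linarith) hd
      calc volume (B ∩ {x | BisectHit P (n + 1) c d x})
          ≤ volume ((B ∩ {x | BisectHit P n c ((c + d) / 2) x}) ∪
              (B ∩ {x | BisectHit P n ((c + d) / 2) d x})) := by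
            refine measure_mono ?_
            rintro x ⟨hx, h' | h' | h'⟩
            · exact absurd h'.2 h
            · exact Or.inl ⟨hx, h'⟩
            · exact Or.inr ⟨hx, h'⟩
        _ ≤ _ := (measure_union_le _ _).trans (add_le_add h1 h2)
        _ = _ := by
            rw [← ENNReal.ofReal_add (mul_nonneg hη (by linarith)) (mul_nonneg hη (by linarith))]
            congr 1; ring

/-- `P` fails on `[c, d)` but holds on one of its halves. -/
def HoldsOnHalf (P : ℝ → ℝ → Prop) (c d : ℝ) : Prop :=
  ¬ P c d ∧ (P c ((c + d) / 2) ∨ P ((c + d) / 2) d)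

lemma exists_bisectHit {P : ℝ → ℝ → Prop} {c d x : ℝ} (n : ℕ) (hx : x ∈ Set.Ico c d)
    (h : ∀ c' d', c ≤ c' → d' ≤ d → x ∈ Set.Ico c' d' → d' - c' ≤ (d - c) / 2 ^ n → P c' d')
    (hP : ¬ P c d) : BisectHit (HoldsOnHalf P) n c d x := by
  induction n generalizing c d with
  | zero => exact absurd (h c d le_rfl le_rfl hx (by simp)) hP
  | succ n ih =>
    have hcd := hx.1.trans_lt hx.2
    by_cases hm : x < (c + d) / 2
    · by_cases hQ : P c ((c + d) / 2)
      · exact Or.inl ⟨hx, hP, Or.inl hQ⟩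
      · refine Or.inr (Or.inl (ih ⟨hx.1, hm⟩ (fun c' d' hc' hd' hx' hl => h c' d' hc'
          (by linarith) hx' (hl.trans_eq ?_)) hQ))
        rw [pow_succ]; field_simp; ring
    · by_cases hQ : P ((c + d) / 2) d
      · exact Or.inl ⟨hx, hP, Or.inr hQ⟩
      · refine Or.inr (Or.inr (ih ⟨not_lt.1 hm, hx.2⟩ (fun c' d' hc' hd' hx' hl => h c' d'
          (by linarith) hd' hx' (hl.trans_eq ?_)) hQ))
        rw [pow_succ]; field_simp; ring

/-- Stopping-time covering bound: if `P` holds on all short intervals around points of `B`, fails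
on `[c, d)`, and `B` has density at most `η` in each interval where `P` first starts to fail, then
`B` has density at most `η` in `[c, d)`. -/
lemma volume_le_of_holdsOnHalf {P : ℝ → ℝ → Prop} {B : Set ℝ} {c d η : ℝ} (hη : 0 ≤ η)
    (hcd : c < d) (hB : B ⊆ Set.Ico c d)
    (hloc : ∀ x ∈ B, ∃ δ > 0, ∀ c' d', c ≤ c' → d' ≤ d → x ∈ Set.Ico c' d' → d' - c' ≤ δ → P c' d')
    (hP : ¬ P c d)
    (hdens : ∀ c' d', c ≤ c' → c' < d' → d' ≤ d → HoldsOnHalf P c' d' →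
      volume (B ∩ Set.Ico c' d') ≤ ENNReal.ofReal (η * (d' - c'))) :
    volume B ≤ ENNReal.ofReal (η * (d - c)) := by
  have hcover : B = ⋃ n : ℕ, B ∩ {x | BisectHit (HoldsOnHalf P) n c d x} := by
    refine Set.Subset.antisymm (fun x hx => ?_) (Set.iUnion_subset fun n => Set.inter_subset_left)
    obtain ⟨δ, hδ, h⟩ := hloc x hx
    obtain ⟨n, hn⟩ := pow_unbounded_of_one_lt ((d - c) / δ) (one_lt_two (α := ℝ))
    refine Set.mem_iUnion.2 ⟨n, hx, exists_bisectHit n (hB hx) (fun c' d' h1 h2 h3 h4 =>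
      h c' d' h1 h2 h3 (h4.trans ?_)) hP⟩
    rw [div_lt_iff₀ hδ] at hn
    rw [div_le_iff₀ (by positivity)]
    linarith
  have hmono : Monotone fun n : ℕ => B ∩ {x | BisectHit (HoldsOnHalf P) n c d x} :=
    monotone_nat_of_le_succ fun n x hx => ⟨hx.1, hx.2.succ⟩
  rw [hcover, hmono.measure_iUnion]
  exact iSup_le fun n => volume_inter_bisectHit_le hη hdens n le_rfl hcd le_rfl

lemma IsGood.volume_le {N : ℝ → ℝ} {C u v κ ρ c d : ℝ} (hN : IsGood C u v N) (hC : 0 ≤ C)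
    (hκ : 0 < κ) (hρ : 0 < ρ) (hc : u ≤ c) (hcd : c < d) (hd : d ≤ v)
    (h : ∃ z ∈ Set.Ico c d, ρ ≤ N z) :
    volume {x ∈ Set.Ico c d | N x < κ} ≤ ENNReal.ofReal (√(C * κ / ρ) * (d - c)) := by
  have h1 := hN.bound c d κ ρ hc hcd hd hκ hρ h
  have hfin : volume {x ∈ Set.Ico c d | N x < κ} ≠ ⊤ :=
    ((measure_mono (Set.sep_subset _ _)).trans_lt (by simp)).ne
  rw [← ENNReal.ofReal_toReal hfin]
  refine ENNReal.ofReal_le_ofReal (abs_le_of_sq_le_sq' ?_ ?_).2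
  · rw [mul_pow, Real.sq_sqrt (by positivity), div_mul_eq_mul_div, le_div_iff₀ hρ, mul_comm]
    exact h1
  · exact mul_nonneg (Real.sqrt_nonneg _) (by linarith)

lemma exists_forall_lt_of_half {ι : Type*} {N : ι → ℝ → ℝ} {C u v ρ c d : ℝ} (hC : 0 ≤ C)
    (hN : ∀ i, IsGood C u v (N i)) (hρ : 0 < ρ) (hc : u ≤ c) (hcd : c < d) (hd : d ≤ v)
    (h : (∃ i, ∀ z ∈ Set.Ico c ((c + d) / 2), N i z < ρ) ∨
      ∃ i, ∀ z ∈ Set.Ico ((c + d) / 2) d, N i z < ρ) :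
    ∃ i, ∀ z ∈ Set.Ico c d, N i z < (4 * C + 1) * ρ := by
  have key : ∀ i c' d', d' - c' = (d - c) / 2 → c ≤ c' → d' ≤ d →
      (∀ z ∈ Set.Ico c' d', N i z < ρ) → ∀ z ∈ Set.Ico c d, N i z < (4 * C + 1) * ρ := by
    intro i c' d' hl hc' hd' hi z hz
    by_contra hcon
    have h1 := (hN i).bound c d ρ ((4 * C + 1) * ρ) hc hcd hd hρ (by positivity)
      ⟨z, hz, not_lt.1 hcon⟩
    have h2 : (d - c) / 2 ≤ volume.real {x ∈ Set.Ico c d | N i x < ρ} := by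
      rw [← hl]
      have : volume.real (Set.Ico c' d') = d' - c' := by
        rw [Real.volume_real_Ico, max_eq_left]; linarith
      rw [← this]
      refine measureReal_mono (fun x hx => ⟨⟨hc'.trans hx.1, hx.2.trans_le hd'⟩, hi x hx⟩) ?_
      exact ((measure_mono (Set.sep_subset _ _)).trans_lt (by simp)).ne
    have hpos : 0 < d - c := by linarith
    have h3 : ((d - c) / 2) ^ 2 ≤ volume.real {x ∈ Set.Ico c d | N i x < ρ} ^ 2 := by gcongr
    have h4 : (4 * C + 1) * ρ * ((d - c) / 2) ^ 2 ≤ C * ρ * (d - c) ^ 2 :=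
      (mul_le_mul_of_nonneg_left h3 (by positivity)).trans h1
    have : 0 < ρ * (d - c) ^ 2 := by positivity
    nlinarith
  rcases h with ⟨i, hi⟩ | ⟨i, hi⟩
  · exact ⟨i, key i _ _ (by ring) le_rfl (by linarith) hi⟩
  · exact ⟨i, key i _ _ (by ring) (by linarith) le_rfl hi⟩

/-- If each member of a family of good functions is somewhere at least `ρ` on `[c, d)`, and near
each point of `B` all members below `K₀ * ρ` are below `κ`, then `B` is small. -/
lemma volume_le_of_isGood_family {ι : Type*} {N : ι → ℝ → ℝ} {C u v κ ρ c d : ℝ} {B : Set ℝ}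
    (hC : 0 ≤ C) (hN : ∀ i, IsGood C u v (N i)) (hκ : 0 < κ) (hκρ : κ ≤ ρ) (hc : u ≤ c)
    (hcd : c < d) (hd : d ≤ v) (hB : B ⊆ Set.Ico c d)
    (hlarge : ∀ i, ∃ z ∈ Set.Ico c d, ρ ≤ N i z)
    (hsmall : ∀ x ∈ B, ∃ i, N i x < κ)
    (hgap : ∀ x ∈ B, ∀ i, N i x < (4 * C + 1) * ρ → N i x < κ) :
    volume B ≤ ENNReal.ofReal (√(C * κ / ρ) * (d - c)) := by
  have hρ : 0 < ρ := hκ.trans_le hκρ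
  refine volume_le_of_holdsOnHalf (P := fun c d => ∃ i, ∀ z ∈ Set.Ico c d, N i z < ρ)
    (Real.sqrt_nonneg _) hcd hB ?_ ?_ ?_
  · intro x hx
    obtain ⟨i, hi⟩ := hsmall x hx
    have hxm : x ∈ Set.Icc u v := ⟨hc.trans (hB hx).1, (hB hx).2.le.trans hd⟩
    have := (hN i).cont x hxm (Iio_mem_nhds (hi.trans_le hκρ))
    obtain ⟨δ, hδ, h⟩ := Metric.mem_nhdsWithin_iff.1 this
    refine ⟨δ, hδ, fun c' d' hc' hd' hx' hl => ⟨i, fun z hz => h ⟨?_, ?_⟩⟩⟩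
    · rw [Metric.mem_ball, Real.dist_eq, abs_lt]
      constructor <;> linarith [hx'.1, hx'.2, hz.1, hz.2]
    · exact ⟨by linarith [hz.1], by linarith [hz.2]⟩
  · rintro ⟨i, hi⟩
    obtain ⟨z, hz, hzρ⟩ := hlarge i
    exact absurd (hi z hz) (not_lt.2 hzρ)
  · rintro c' d' hc' hcd' hd' ⟨hnot, hhalf⟩
    push Not at hnot
    obtain ⟨i, hi⟩ : ∃ i, ∀ z ∈ Set.Ico c' d', N i z < (4 * C + 1) * ρ :=
      exists_forall_lt_of_half hC hN hρ (hc.trans hc') hcd' (hd'.trans hd) hhalf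
    have hsub : B ∩ Set.Ico c' d' ⊆ {x ∈ Set.Ico c' d' | N i x < κ} :=
      fun x hx => ⟨hx.2, hgap x hx.1 i (hi x hx.2)⟩
    exact (measure_mono hsub).trans ((hN i).volume_le hC hκ hρ (hc.trans hc') hcd' (hd'.trans hd)
      (hnot i))

/-- If one member of a family of good functions is below `K₀ * ρ` on `[c, d)`, while all members of
a second family reach `ρ`, and the two families are in duality, then few points of `[c, d)` are
very small for the second family. -/
lemma volume_le_of_dual {ι : Type*} {M : ℝ → ℝ} {N : ι → ℝ → ℝ} {C u v κ ρ c d : ℝ} {B : Set ℝ}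
    (hC : 0 ≤ C) (hM : IsGood C u v M) (hN : ∀ i, IsGood C u v (N i)) (hκ : 0 < κ) (hκρ : κ ≤ ρ)
    (hc : u ≤ c) (hcd : c < d) (hd : d ≤ v) (hB : B ⊆ Set.Ico c d)
    (hMlarge : ∃ z ∈ Set.Ico c d, ρ ≤ M z)
    (hlarge : ∀ i, ∃ z ∈ Set.Ico c d, ρ ≤ N i z)
    (hsmall : ∀ x ∈ B, M x < κ ∨ ∃ i, N i x < κ)
    (hdual : ∀ x ∈ B, ∀ i j, N i x < (4 * C + 1) * ρ → N j x < κ → M x < κ ∨ N i x < κ) :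
    volume B ≤ ENNReal.ofReal (2 * √(C * κ / ρ) * (d - c)) := by
  have h1 := hM.volume_le hC hκ (hκ.trans_le hκρ) hc hcd hd hMlarge
  have h2 : volume (B \ {x | M x < κ}) ≤ ENNReal.ofReal (√(C * κ / ρ) * (d - c)) := by
    have hs : ∀ x ∈ B \ {x | M x < κ}, ∃ i, N i x < κ :=
      fun x hx => (hsmall x hx.1).resolve_left hx.2
    refine volume_le_of_isGood_family hC hN hκ hκρ hc hcd hd (Set.sdiff_subset.trans hB)
      hlarge hs ?_
    intro x hx i hi
    obtain ⟨j, hj⟩ := hs x hx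
    exact (hdual x hx.1 i j hi hj).resolve_left hx.2
  have hsub : B ⊆ {x ∈ Set.Ico c d | M x < κ} ∪ (B \ {x | M x < κ}) := by
    intro x hx
    by_cases h : M x < κ
    · exact Or.inl ⟨hB hx, h⟩
    · exact Or.inr ⟨hx, h⟩
  refine (measure_mono hsub).trans ((measure_union_le _ _).trans ((add_le_add h1 h2).trans_eq ?_))
  rw [← ENNReal.ofReal_add]
  · congr 1; ring
  all_goals exact mul_nonneg (Real.sqrt_nonneg _) (by linarith)

/-- Quantitative nondivergence for two families of good functions in duality. -/
theorem volume_small_le_of_dual_families {V W : Type*} {N : V → ℝ → ℝ} {M : W → ℝ → ℝ}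
    {C κ ρ c d : ℝ} (hC : 0 ≤ C) (hN : ∀ i, IsGood C c d (N i)) (hM : ∀ a, IsGood C c d (M a))
    (hκ : 0 < κ) (hκρ : κ ≤ ρ) (hcd : c < d)
    (hNlarge : ∀ i, ∃ z ∈ Set.Ico c d, ρ ≤ N i z)
    (hMlarge : ∀ a, ∃ z ∈ Set.Ico c d, ρ ≤ M a z)
    (hdualN : ∀ x ∈ Set.Ico c d, ∀ a i j, M a x < (4 * C + 1) * ρ → N i x < (4 * C + 1) * ρ →
      N j x < κ → M a x < κ ∨ N i x < κ)
    (hdualM : ∀ x ∈ Set.Ico c d, ∀ i a b, N i x < (4 * C + 1) * ρ → M a x < (4 * C + 1) * ρ →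
      M b x < κ → N i x < κ ∨ M a x < κ)
    (hcross : ∀ x ∈ Set.Ico c d, ∀ i j, N i x < (4 * C + 1) * ρ → N j x < κ →
      N i x < κ ∨ ∃ a, M a x < κ) :
    volume {x ∈ Set.Ico c d | ∃ i, N i x < κ} ≤
      ENNReal.ofReal (2 * √(C * κ / ρ) * (d - c)) := by
  have hρ : 0 < ρ := hκ.trans_le hκρ
  let S : V ⊕ W → ℝ → ℝ := Sum.elim N M
  have hS : ∀ s, IsGood C c d (S s) := by rintro (i | a); exacts [hN i, hM a]
  refine volume_le_of_holdsOnHalf (P := fun c d => ∃ s, ∀ z ∈ Set.Ico c d, S s z < ρ)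
    (by positivity) hcd (Set.sep_subset _ _) ?_ ?_ ?_
  · rintro x ⟨hx, i, hi⟩
    have := (hN i).cont x ⟨hx.1, hx.2.le⟩ (Iio_mem_nhds (hi.trans_le hκρ))
    obtain ⟨δ, hδ, h⟩ := Metric.mem_nhdsWithin_iff.1 this
    refine ⟨δ, hδ, fun c' d' hc' hd' hx' hl => ⟨Sum.inl i, fun z hz => h ⟨?_, ?_⟩⟩⟩
    · rw [Metric.mem_ball, Real.dist_eq, abs_lt]
      constructor <;> linarith [hx'.1, hx'.2, hz.1, hz.2]
    · exact ⟨by linarith [hz.1], by linarith [hz.2]⟩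
  · rintro ⟨i | a, hs⟩
    · obtain ⟨z, hz, hzρ⟩ := hNlarge i
      exact absurd (hs z hz) (not_lt.2 hzρ)
    · obtain ⟨z, hz, hzρ⟩ := hMlarge a
      exact absurd (hs z hz) (not_lt.2 hzρ)
  · rintro c' d' hc' hcd' hd' ⟨hnot, hhalf⟩
    push Not at hnot
    have hsub : Set.Ico c' d' ⊆ Set.Ico c d := Set.Ico_subset_Ico hc' hd'
    obtain ⟨i | a, hs⟩ := exists_forall_lt_of_half hC hS hρ hc' hcd' hd' hhalf
    · refine volume_le_of_dual hC (hN i) hM hκ hκρ hc' hcd' hd' Set.inter_subset_right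
        (hnot (Sum.inl i)) (fun a => hnot (Sum.inr a)) ?_ ?_
      · rintro x ⟨⟨hx, j, hj⟩, hx'⟩
        exact hcross x hx i j (hs x hx') hj
      · rintro x ⟨⟨hx, -⟩, hx'⟩ a b ha hb
        exact hdualM x hx i a b (hs x hx') ha hb
    · refine volume_le_of_dual hC (hM a) hN hκ hκρ hc' hcd' hd' Set.inter_subset_right
        (hnot (Sum.inr a)) (fun i => hnot (Sum.inl i)) ?_ ?_
      · rintro x ⟨⟨hx, j, hj⟩, hx'⟩
        exact Or.inr ⟨j, hj⟩
      · rintro x ⟨⟨hx, -⟩, hx'⟩ i j hi hj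
        exact hdualN x hx a i j (hs x hx') hi hj

/-- `f` has first and second derivatives `f₁`, `f₂` on `[u, v]`, with `f₁` bounded and `|f₂|`
bounded above and below. -/
structure CurveOn (f f₁ f₂ : ℝ → ℝ) (u v K : ℝ) : Prop where
  one_le : 1 ≤ K
  deriv : ∀ x ∈ Set.Icc u v, HasDerivAt f (f₁ x) x
  deriv₂ : ∀ x ∈ Set.Icc u v, HasDerivAt f₁ (f₂ x) x
  bound : ∀ x ∈ Set.Icc u v, |f₁ x| ≤ K
  lo : ∀ x ∈ Set.Icc u v, K⁻¹ ≤ |f₂ x|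
  hi : ∀ x ∈ Set.Icc u v, |f₂ x| ≤ K

lemma CurveOn.mono {f f₁ f₂ : ℝ → ℝ} {u v u' v' K : ℝ} (H : CurveOn f f₁ f₂ u v K) (hu : u ≤ u')
    (hv : v' ≤ v) : CurveOn f f₁ f₂ u' v' K := by
  have h : Set.Icc u' v' ⊆ Set.Icc u v := Set.Icc_subset_Icc hu hv
  exact ⟨H.one_le, fun x hx => H.deriv x (h hx), fun x hx => H.deriv₂ x (h hx),
    fun x hx => H.bound x (h hx), fun x hx => H.lo x (h hx), fun x hx => H.hi x (h hx)⟩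

lemma CurveOn.slope {f f₁ f₂ : ℝ → ℝ} {u v K : ℝ} (H : CurveOn f f₁ f₂ u v K) {x y : ℝ}
    (hx : x ∈ Set.Icc u v) (hy : y ∈ Set.Icc u v) :
    K⁻¹ * |x - y| ≤ |f₁ x - f₁ y| ∧ |f₁ x - f₁ y| ≤ K * |x - y| := by
  have key : ∀ {x y}, x ∈ Set.Icc u v → y ∈ Set.Icc u v → y < x →
      K⁻¹ * |x - y| ≤ |f₁ x - f₁ y| ∧ |f₁ x - f₁ y| ≤ K * |x - y| := by
    intro x y hx hy hxy
    obtain ⟨z, -, hz, h⟩ := exists_mul_sub_of_hasDerivAt H.deriv₂ hy hx hxy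
    rw [h, abs_mul]
    exact ⟨mul_le_mul_of_nonneg_right (H.lo z hz) (abs_nonneg _),
      mul_le_mul_of_nonneg_right (H.hi z hz) (abs_nonneg _)⟩
  rcases lt_trichotomy x y with h | rfl | h
  · rw [abs_sub_comm x, abs_sub_comm (f₁ x)]; exact key hy hx h
  · simp
  · exact key hx hy h

lemma CurveOn.abs_sub_le {f f₁ f₂ : ℝ → ℝ} {u v K : ℝ} (H : CurveOn f f₁ f₂ u v K) {x y : ℝ}
    (hx : x ∈ Set.Icc u v) (hy : y ∈ Set.Icc u v) : |f x - f y| ≤ K * |x - y| := by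
  have key : ∀ {x y}, x ∈ Set.Icc u v → y ∈ Set.Icc u v → y < x → |f x - f y| ≤ K * |x - y| := by
    intro x y hx hy hxy
    obtain ⟨z, -, hz, h⟩ := exists_mul_sub_of_hasDerivAt H.deriv hy hx hxy
    rw [h, abs_mul]
    exact mul_le_mul_of_nonneg_right (H.bound z hz) (abs_nonneg _)
  rcases lt_trichotomy x y with h | rfl | h
  · rw [abs_sub_comm x, abs_sub_comm (f x)]; exact key hy hx h
  · simp
  · exact key hx hy h

lemma CurveOn.taylor {f f₁ f₂ : ℝ → ℝ} {u v K : ℝ} (H : CurveOn f f₁ f₂ u v K) {x y : ℝ}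
    (hx : x ∈ Set.Icc u v) (hy : y ∈ Set.Icc u v) :
    |f y - f x - f₁ x * (y - x)| ≤ K * |y - x| ^ 2 := by
  have hK : 0 ≤ K := zero_le_one.trans H.one_le
  have fin : ∀ z ∈ Set.Icc u v, |z - x| ≤ |y - x| → f y - f x = f₁ z * (y - x) →
      |f y - f x - f₁ x * (y - x)| ≤ K * |y - x| ^ 2 := by
    intro z hz hzx h
    rw [h, ← sub_mul, abs_mul, pow_two, ← mul_assoc]
    exact mul_le_mul_of_nonneg_right ((H.slope hz hx).2.trans
      (mul_le_mul_of_nonneg_left hzx hK)) (abs_nonneg _)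
  rcases lt_trichotomy x y with h | rfl | h
  · obtain ⟨z, hz, hzm, hzz⟩ := exists_mul_sub_of_hasDerivAt H.deriv hx hy h
    refine fin z hzm ?_ hzz
    rw [abs_of_pos (by linarith [hz.1]), abs_of_pos (by linarith)]; linarith [hz.2]
  · simp
  · obtain ⟨z, hz, hzm, hzz⟩ := exists_mul_sub_of_hasDerivAt H.deriv hy hx h
    refine fin z hzm ?_ (by linear_combination -hzz)
    rw [abs_of_neg (by linarith [hz.2]), abs_of_neg (by linarith)]; linarith [hz.1]

/-- Integer vectors: `(q, p₁, p₂)` for rational points, `(a₀, a₁, a₂)` for rational lines. -/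
abbrev IntVec := ℤ × ℤ × ℤ

namespace IntVec

def dot (v w : IntVec) : ℤ := v.1 * w.1 + v.2.1 * w.2.1 + v.2.2 * w.2.2

def cross (v w : IntVec) : IntVec :=
  (v.2.1 * w.2.2 - v.2.2 * w.2.1, v.2.2 * w.1 - v.1 * w.2.2, v.1 * w.2.1 - v.2.1 * w.1)

def scale (m : ℤ) (v : IntVec) : IntVec := (m * v.1, m * v.2.1, m * v.2.2)

/-- A primitive integer vector, in Bézout form. -/
def IsPrimitive (v : IntVec) : Prop := ∃ w, dot w v = 1

lemma ext' {v w : IntVec} (h₁ : v.1 = w.1) (h₂ : v.2.1 = w.2.1) (h₃ : v.2.2 = w.2.2) : v = w :=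
  Prod.ext h₁ (Prod.ext h₂ h₃)

lemma exists_scale_isPrimitive {v : IntVec} (hv : v ≠ (0, 0, 0)) :
    ∃ m : ℤ, m ≠ 0 ∧ ∃ w, IsPrimitive w ∧ v = scale m w := by
  obtain ⟨a, b, c⟩ := v
  obtain ⟨g, hg⟩ := IsPrincipalIdealRing.principal (Ideal.span {a, b, c})
  have hmem : ∀ z ∈ ({a, b, c} : Set ℤ), g ∣ z := by
    intro z hz
    have : z ∈ Ideal.span {a, b, c} := Ideal.subset_span hz
    rw [hg] at this
    exact Ideal.mem_span_singleton.1 this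
  obtain ⟨a', ha⟩ := hmem a (by simp)
  obtain ⟨b', hb⟩ := hmem b (by simp)
  obtain ⟨c', hc⟩ := hmem c (by simp)
  have hg0 : g ≠ 0 := by
    rintro rfl
    simp at ha hb hc
    exact hv (by simp [ha, hb, hc])
  have hgm : g ∈ Ideal.span {a, b, c} := by rw [hg]; exact Ideal.mem_span_singleton_self g
  obtain ⟨x, z, hz, h1⟩ := Ideal.mem_span_insert.1 hgm
  obtain ⟨y, t, ht, h2⟩ := Ideal.mem_span_insert.1 hz
  obtain ⟨s, hs⟩ := Ideal.mem_span_singleton'.1 ht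
  refine ⟨g, hg0, (a', b', c'), ⟨(x, y, s), ?_⟩, ?_⟩
  · refine mul_left_cancel₀ hg0 ?_
    simp only [dot]
    linear_combination -h1 - h2 + hs - x * ha - y * hb - s * hc
  · exact ext' ha hb hc

lemma eq_or_eq_neg_of_cross_eq_zero {v w : IntVec} (hv : IsPrimitive v) (hw : IsPrimitive w)
    (h : cross v w = (0, 0, 0)) : w = scale 1 v ∨ w = scale (-1) v := by
  obtain ⟨s, hs⟩ := hv
  obtain ⟨t, ht⟩ := hw
  simp only [cross, Prod.mk.injEq] at h
  obtain ⟨h1, h2, h3⟩ := h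
  simp only [dot] at hs ht
  have key : w = scale (dot s w) v := by
    refine ext' ?_ ?_ ?_ <;> simp only [dot, scale]
    · linear_combination -w.1 * hs - s.2.1 * h3 + s.2.2 * h2
    · linear_combination -w.2.1 * hs + s.1 * h3 - s.2.2 * h1
    · linear_combination -w.2.2 * hs - s.1 * h2 + s.2.1 * h1
  have hunit : dot s w * dot t v = 1 := by
    have hk1 := congrArg (fun z : IntVec => z.1) key
    have hk2 := congrArg (fun z : IntVec => z.2.1) key
    have hk3 := congrArg (fun z : IntVec => z.2.2) key
    simp only [scale] at hk1 hk2 hk3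
    have : dot s w * dot t v = t.1 * w.1 + t.2.1 * w.2.1 + t.2.2 * w.2.2 := by
      rw [hk1, hk2, hk3]; simp only [dot]; ring
    rw [this, ht]
  rcases Int.eq_one_or_neg_one_of_mul_eq_one hunit with h' | h'
  · left; rw [← h']; exact key
  · right; rw [← h']; exact key

lemma exists_cross_eq_scale {v w a : IntVec} (ha : IsPrimitive a) (hv : dot v a = 0)
    (hw : dot w a = 0) : ∃ m, cross v w = scale m a := by
  obtain ⟨s, hs⟩ := ha
  refine ⟨dot s (cross v w), ?_⟩
  simp only [dot] at hs hv hw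
  refine ext' ?_ ?_ ?_ <;> simp only [dot, cross, scale]
  · linear_combination -(v.2.1 * w.2.2 - v.2.2 * w.2.1) * hs
      + (s.2.1 * w.2.2 - s.2.2 * w.2.1) * hv - (s.2.1 * v.2.2 - s.2.2 * v.2.1) * hw
  · linear_combination -(v.2.2 * w.1 - v.1 * w.2.2) * hs
      + (s.2.2 * w.1 - s.1 * w.2.2) * hv - (s.2.2 * v.1 - s.1 * v.2.2) * hw
  · linear_combination -(v.1 * w.2.1 - v.2.1 * w.1) * hs
      + (s.1 * w.2.1 - s.2.1 * w.1) * hv - (s.1 * v.2.1 - s.2.1 * v.1) * hw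

end IntVec

/-- The size at `x` of the integer point `v = (q, p₁, p₂)`, relative to the tangent flag of the
curve at `x`. -/
noncomputable def pointNrm (f f₁ : ℝ → ℝ) (A B D : ℝ) (v : IntVec) : ℝ → ℝ :=
  nrm A B D (fun x => v.1 * f x - v.2.2 + f₁ x * (v.2.1 - v.1 * x)) (fun x => v.2.1 - v.1 * x) v.1

/-- The size at `x` of the integer line `a₀ + a₁ X + a₂ Y = 0`, dual to `pointNrm`. -/
noncomputable def lineNrm (f f₁ : ℝ → ℝ) (A B D : ℝ) (a : IntVec) : ℝ → ℝ :=
  nrm A B D (fun x => a.1 + a.2.1 * x + a.2.2 * f x) (fun x => a.2.1 + a.2.2 * f₁ x) a.2.2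

lemma CurveOn.isGood_pointNrm {f f₁ f₂ : ℝ → ℝ} {u v K : ℝ} (H : CurveOn f f₁ f₂ u v K)
    {A B D : ℝ} (hA : 0 < A) (hB : 0 < B) (hD : 0 < D) (w : IntVec) :
    IsGood (343 * K ^ 4) u v (pointNrm f f₁ A B D w) := by
  have hK := H.one_le
  have hK' : K⁻¹ ≤ 1 := inv_le_one_of_one_le₀ hK
  refine QuadraticLike.isGood (h := f₂) ⟨?_, H.lo, H.hi, ?_, ?_⟩ hK hA hB hD
  · intro x hx
    have h1 := (H.deriv x hx).const_mul (w.1 : ℝ)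
    have h2 : HasDerivAt (fun x : ℝ => (w.2.1 : ℝ) - w.1 * x) (-w.1) x := by
      simpa using ((hasDerivAt_id x).const_mul (w.1 : ℝ)).const_sub (w.2.1 : ℝ)
    exact ((h1.sub_const (w.2.2 : ℝ)).add ((H.deriv₂ x hx).mul h2)).congr_deriv (by ring)
  · intro x _ y _
    have : ((w.2.1 : ℝ) - w.1 * x) - (w.2.1 - w.1 * y) = -(w.1 * (x - y)) := by ring
    rw [this, abs_neg, abs_mul, mul_assoc]
    exact mul_le_of_le_one_left (by positivity) hK'
  · intro x _ y _
    have : ((w.2.1 : ℝ) - w.1 * x) - (w.2.1 - w.1 * y) = -(w.1 * (x - y)) := by ring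
    rw [this, abs_neg, abs_mul, mul_assoc]
    exact le_mul_of_one_le_left (by positivity) hK

lemma CurveOn.isGood_lineNrm {f f₁ f₂ : ℝ → ℝ} {u v K : ℝ} (H : CurveOn f f₁ f₂ u v K)
    {A B D : ℝ} (hA : 0 < A) (hB : 0 < B) (hD : 0 < D) (a : IntVec) :
    IsGood (343 * K ^ 4) u v (lineNrm f f₁ A B D a) := by
  have hK := H.one_le
  have hK' : K⁻¹ ≤ 1 := inv_le_one_of_one_le₀ hK
  refine QuadraticLike.isGood (h := fun _ => 1) ⟨?_, fun _ _ => by simpa using hK',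
    fun _ _ => by simpa using hK, ?_, ?_⟩ hK hA hB hD
  · intro x hx
    have h1 := (H.deriv x hx).const_mul (a.2.2 : ℝ)
    have h2 : HasDerivAt (fun x : ℝ => (a.1 : ℝ) + a.2.1 * x) a.2.1 x := by
      simpa using ((hasDerivAt_id x).const_mul (a.2.1 : ℝ)).const_add (a.1 : ℝ)
    exact (h2.add h1).congr_deriv (by ring)
  · intro x hx y hy
    have : ((a.2.1 : ℝ) + a.2.2 * f₁ x) - (a.2.1 + a.2.2 * f₁ y) = a.2.2 * (f₁ x - f₁ y) := by ring
    rw [this, abs_mul, mul_comm K⁻¹, mul_assoc]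
    exact mul_le_mul_of_nonneg_left (H.slope hx hy).1 (abs_nonneg _)
  · intro x hx y hy
    have : ((a.2.1 : ℝ) + a.2.2 * f₁ x) - (a.2.1 + a.2.2 * f₁ y) = a.2.2 * (f₁ x - f₁ y) := by ring
    rw [this, abs_mul, mul_comm K, mul_assoc]
    exact mul_le_mul_of_nonneg_left (H.slope hx hy).2 (abs_nonneg _)

lemma one_le_abs_intCast {m : ℤ} (hm : m ≠ 0) : (1 : ℝ) ≤ |(m : ℝ)| := by
  exact_mod_cast Int.one_le_abs hm

lemma nrm_le_of_scale {A B D : ℝ} (hA : 0 < A) (hB : 0 < B) (hD : 0 < D) {φ lam φ' lam' : ℝ → ℝ}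
    {k k' x t : ℝ} (ht : 1 ≤ |t|) (h₁ : φ' x = t * φ x) (h₂ : lam' x = t * lam x)
    (h₃ : k' = t * k) : nrm A B D φ lam k x ≤ nrm A B D φ' lam' k' x := by
  unfold nrm
  rw [h₁, h₂, h₃, abs_mul, abs_mul, abs_mul]
  gcongr <;> exact le_mul_of_one_le_left (abs_nonneg _) ht

lemma pointNrm_le_scale {f f₁ : ℝ → ℝ} {A B D : ℝ} (hA : 0 < A) (hB : 0 < B) (hD : 0 < D) {m : ℤ}
    (hm : m ≠ 0) (v : IntVec) (x : ℝ) :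
    pointNrm f f₁ A B D v x ≤ pointNrm f f₁ A B D (v.scale m) x := by
  refine nrm_le_of_scale hA hB hD (one_le_abs_intCast hm) ?_ ?_ ?_ <;>
    simp only [IntVec.scale] <;> push_cast <;> ring

lemma lineNrm_le_scale {f f₁ : ℝ → ℝ} {A B D : ℝ} (hA : 0 < A) (hB : 0 < B) (hD : 0 < D) {m : ℤ}
    (hm : m ≠ 0) (v : IntVec) (x : ℝ) :
    lineNrm f f₁ A B D v x ≤ lineNrm f f₁ A B D (v.scale m) x := by
  refine nrm_le_of_scale hA hB hD (one_le_abs_intCast hm) ?_ ?_ ?_ <;>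
    simp only [IntVec.scale] <;> push_cast <;> ring

/-- A `2 × 2` minor bound. -/
lemma abs_mul_sub_mul_lt {a b c d s t A B E : ℝ} (ha : |a| < s * A) (hb : |b| < t * B)
    (hc : |c| < s * B) (hd : |d| < t * A) (hE : A * B = E) : |a * b - c * d| < 2 * s * t * E := by
  have h1 : |a| * |b| < (s * A) * (t * B) := mul_lt_mul'' ha hb (abs_nonneg _) (abs_nonneg _)
  have h2 : |c| * |d| < (s * B) * (t * A) := mul_lt_mul'' hc hd (abs_nonneg _) (abs_nonneg _)
  have h3 := abs_sub (a * b) (c * d)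
  rw [abs_mul, abs_mul] at h3
  rw [← hE]
  nlinarith

section Duality

variable {f f₁ : ℝ → ℝ} {A B D : ℝ}

lemma lineNrm_cross_lt (hA : 0 < A) (hB : 0 < B) (hD : 0 < D) (hABD : A * B * D = 1)
    {v w : IntVec} {x s t : ℝ} (hv : pointNrm f f₁ A B D v x < s)
    (hw : pointNrm f f₁ A B D w x < t) :
    lineNrm f f₁ D⁻¹ B⁻¹ A⁻¹ (v.cross w) x < 2 * s * t := by
  rw [pointNrm, nrm_lt_iff hA hB hD] at hv hw
  rw [lineNrm, nrm_lt_iff (by positivity) (by positivity) (by positivity)]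
  obtain ⟨v1, v2, v3⟩ := hv
  obtain ⟨w1, w2, w3⟩ := hw
  refine ⟨?_, ?_, ?_⟩
  · convert abs_mul_sub_mul_lt v1 w2 v2 w1 (E := D⁻¹) (by field_simp; linarith) using 2
    simp only [IntVec.cross]; push_cast; ring
  · convert abs_mul_sub_mul_lt v3 w1 v1 w3 (E := B⁻¹) (by field_simp; linarith) using 2
    simp only [IntVec.cross]; push_cast; ring
  · convert abs_mul_sub_mul_lt v3 w2 v2 w3 (E := A⁻¹) (by field_simp; linarith) using 2
    simp only [IntVec.cross]; push_cast; ring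

lemma pointNrm_cross_lt (hA : 0 < A) (hB : 0 < B) (hD : 0 < D) (hABD : A * B * D = 1)
    {a b : IntVec} {x s t : ℝ} (ha : lineNrm f f₁ D⁻¹ B⁻¹ A⁻¹ a x < s)
    (hb : lineNrm f f₁ D⁻¹ B⁻¹ A⁻¹ b x < t) :
    pointNrm f f₁ A B D (a.cross b) x < 2 * s * t := by
  rw [lineNrm, nrm_lt_iff (by positivity) (by positivity) (by positivity)] at ha hb
  rw [pointNrm, nrm_lt_iff hA hB hD]
  obtain ⟨a1, a2, a3⟩ := ha
  obtain ⟨b1, b2, b3⟩ := hb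
  refine ⟨?_, ?_, ?_⟩
  · convert abs_mul_sub_mul_lt a2 b1 a1 b2 (E := A) (by field_simp; linarith) using 2
    simp only [IntVec.cross]; push_cast; ring
  · convert abs_mul_sub_mul_lt a3 b1 a1 b3 (E := B) (by field_simp; linarith) using 2
    simp only [IntVec.cross]; push_cast; ring
  · convert abs_mul_sub_mul_lt a2 b3 a3 b2 (E := D) (by field_simp; linarith) using 2
    simp only [IntVec.cross]; push_cast; ring

lemma dot_eq_zero_of_nrm_lt (hA : 0 < A) (hB : 0 < B) (hD : 0 < D)
    {v a : IntVec} {x s t : ℝ} (hv : pointNrm f f₁ A B D v x < s)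
    (ha : lineNrm f f₁ D⁻¹ B⁻¹ A⁻¹ a x < t) (hst : 3 * s * t ≤ 1) : IntVec.dot v a = 0 := by
  rw [pointNrm, nrm_lt_iff hA hB hD] at hv
  rw [lineNrm, nrm_lt_iff (by positivity) (by positivity) (by positivity)] at ha
  obtain ⟨v1, v2, v3⟩ := hv
  obtain ⟨a1, a2, a3⟩ := ha
  have mul : ∀ {y z E : ℝ}, 0 < E → |y| < s * E → |z| < t * E⁻¹ → |y * z| < s * t := by
    intro y z E hE hy hz
    rw [abs_mul]
    calc |y| * |z| < (s * E) * (t * E⁻¹) := mul_lt_mul'' hy hz (abs_nonneg _) (abs_nonneg _)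
      _ = s * t := by field_simp
  have m1 := abs_lt.1 (mul hD v3 a1)
  have m2 := abs_lt.1 (mul hB v2 a2)
  have m3 := abs_lt.1 (mul hA v1 a3)
  have hdot : ((IntVec.dot v a : ℤ) : ℝ) = v.1 * (a.1 + a.2.1 * x + a.2.2 * f x) +
      (v.2.1 - v.1 * x) * (a.2.1 + a.2.2 * f₁ x) -
      (v.1 * f x - v.2.2 + f₁ x * (v.2.1 - v.1 * x)) * a.2.2 := by
    simp only [IntVec.dot]; push_cast; ring
  have : |((IntVec.dot v a : ℤ) : ℝ)| < 1 := by
    rw [hdot, abs_lt]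
    constructor <;> linarith [m1.1, m1.2, m2.1, m2.2, m3.1, m3.2]
  by_contra h
  exact absurd (one_le_abs_intCast h) (not_le.2 this)

lemma IntVec.dot_comm (v w : IntVec) : dot v w = dot w v := by
  simp only [dot]; ring

end Duality

/-- Quantitative nondivergence: for most `x` no primitive integer point is small at `x`. -/
theorem CurveOn.volume_exists_pointNrm_lt_le {f f₁ f₂ : ℝ → ℝ} {c d K : ℝ}
    (H : CurveOn f f₁ f₂ c d K) (hcd : c < d) {A B D κ ρ : ℝ} (hA : 0 < A) (hB : 0 < B)
    (hD : 0 < D) (hABD : A * B * D = 1) (hκ : 0 < κ) (hκρ : κ ≤ ρ)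
    (hρ : 2 * (4 * (343 * K ^ 4) + 1) * ρ = 1)
    (hNlarge : ∀ v : IntVec, v.IsPrimitive → ∃ z ∈ Set.Ico c d, ρ ≤ pointNrm f f₁ A B D v z)
    (hMlarge : ∀ a : IntVec, a.IsPrimitive →
      ∃ z ∈ Set.Ico c d, ρ ≤ lineNrm f f₁ D⁻¹ B⁻¹ A⁻¹ a z) :
    volume {x ∈ Set.Ico c d | ∃ v : IntVec, v.IsPrimitive ∧ pointNrm f f₁ A B D v x < κ} ≤
      ENNReal.ofReal (2 * √(343 * K ^ 4 * κ / ρ) * (d - c)) := by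
  have hr : (4 * (343 * K ^ 4) + 1) * ρ = 1 / 2 := by linarith
  have hκ1 : κ ≤ 1 / 2 := by
    have : ρ ≤ (4 * (343 * K ^ 4) + 1) * ρ :=
      le_mul_of_one_le_left (hκ.le.trans hκρ) (le_add_of_nonneg_left (by positivity))
    linarith
  have hN := fun v : {v : IntVec // v.IsPrimitive} => H.isGood_pointNrm hA hB hD v.1
  have hM := fun a : {a : IntVec // a.IsPrimitive} =>
    H.isGood_lineNrm (A := D⁻¹) (B := B⁻¹) (D := A⁻¹) (by positivity) (by positivity)
      (by positivity) a.1
  have main := volume_small_le_of_dual_families (by positivity) hN hM hκ hκρ hcd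
    (fun v => hNlarge v.1 v.2) (fun a => hMlarge a.1 a.2) ?_ ?_ ?_
  · simpa only [Subtype.exists, exists_prop] using main
  · rintro x - ⟨a, ha⟩ ⟨v, hv⟩ ⟨w, hw⟩ hax hvx hwx
    rw [hr] at hax hvx
    simp only at hax hvx hwx ⊢
    have h1 := dot_eq_zero_of_nrm_lt hA hB hD hvx hax (by norm_num)
    have h2 := dot_eq_zero_of_nrm_lt hA hB hD hwx hax (by linarith)
    obtain ⟨m, hm⟩ := IntVec.exists_cross_eq_scale ha h1 h2
    have h3 := lineNrm_cross_lt hA hB hD hABD hvx hwx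
    by_cases hm0 : m = 0
    · right
      have hz : v.cross w = (0, 0, 0) := by rw [hm, hm0]; simp [IntVec.scale]
      refine lt_of_le_of_lt ?_ hwx
      rcases IntVec.eq_or_eq_neg_of_cross_eq_zero hv hw hz with h | h <;> rw [h] <;>
        exact pointNrm_le_scale hA hB hD (by norm_num) v x
    · left
      refine (lineNrm_le_scale (by positivity) (by positivity) (by positivity) hm0 a x).trans_lt ?_
      rw [← hm]; linarith
  · rintro x - ⟨a, ha⟩ ⟨v, hv⟩ ⟨w, hw⟩ hax hvx hwx
    rw [hr] at hax hvx
    simp only at hax hvx hwx ⊢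
    have h1 := dot_eq_zero_of_nrm_lt hA hB hD hax hvx (by norm_num)
    have h2 := dot_eq_zero_of_nrm_lt hA hB hD hax hwx (by linarith)
    rw [IntVec.dot_comm] at h1 h2
    obtain ⟨m, hm⟩ := IntVec.exists_cross_eq_scale ha h1 h2
    have h3 := pointNrm_cross_lt hA hB hD hABD hvx hwx
    by_cases hm0 : m = 0
    · right
      have hz : v.cross w = (0, 0, 0) := by rw [hm, hm0]; simp [IntVec.scale]
      refine lt_of_le_of_lt ?_ hwx
      rcases IntVec.eq_or_eq_neg_of_cross_eq_zero hv hw hz with h | h <;> rw [h] <;>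
        exact lineNrm_le_scale (by positivity) (by positivity) (by positivity) (by norm_num) v x
    · left
      refine (pointNrm_le_scale hA hB hD hm0 a x).trans_lt ?_
      rw [← hm]; linarith
  · rintro x - ⟨v, hv⟩ ⟨w, hw⟩ hvx hwx
    rw [hr] at hvx
    simp only at hvx hwx ⊢
    by_cases hz : v.cross w = (0, 0, 0)
    · left
      refine lt_of_le_of_lt ?_ hwx
      rcases IntVec.eq_or_eq_neg_of_cross_eq_zero hv hw hz with h | h <;> rw [h] <;>
        exact pointNrm_le_scale hA hB hD (by norm_num) v x
    · right
      obtain ⟨m, hm0, a, ha, hm⟩ := IntVec.exists_scale_isPrimitive hz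
      have h3 := lineNrm_cross_lt hA hB hD hABD hvx hwx
      refine ⟨⟨a, ha⟩, ?_⟩
      refine (lineNrm_le_scale (by positivity) (by positivity) (by positivity) hm0 a x).trans_lt ?_
      rw [← hm]; linarith

lemma IntVec.IsPrimitive.ne_zero {v : IntVec} (hv : v.IsPrimitive) : v ≠ (0, 0, 0) := by
  rintro rfl
  obtain ⟨w, hw⟩ := hv
  simp [IntVec.dot] at hw

lemma exists_le_pointNrm {f f₁ : ℝ → ℝ} {c d ρ δ Q : ℝ} (hcd : c < d) (hρ : 0 < ρ) (hρ1 : ρ ≤ 1)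
    (hδ : 0 < δ) (hδ1 : δ ≤ 1) (hQ : 0 < Q) (h1 : 1 ≤ δ * Q) (h6 : 6 ≤ δ * Q * (d - c))
    {v : IntVec} (hv : v ≠ (0, 0, 0)) :
    ∃ z ∈ Set.Ico c d, ρ ≤ pointNrm f f₁ δ (δ * Q)⁻¹ Q v z := by
  by_contra! hcon
  have hX : 0 < δ * Q := by positivity
  have hXi : 0 < (δ * Q)⁻¹ := by positivity
  have hX1 : (δ * Q)⁻¹ ≤ 1 := inv_le_one_of_one_le₀ h1
  have hB : ρ * (δ * Q)⁻¹ ≤ (d - c) / 6 := by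
    have : (δ * Q)⁻¹ ≤ (d - c) / 6 := by
      rw [inv_le_comm₀ hX (by linarith), inv_div, div_le_iff₀ (by linarith)]; linarith
    nlinarith
  have small : ∀ z ∈ Set.Ico c d, |v.1 * f z - v.2.2 + f₁ z * (v.2.1 - v.1 * z)| < ρ * δ ∧
      |(v.2.1 : ℝ) - v.1 * z| < ρ * (δ * Q)⁻¹ := by
    intro z hz
    have := hcon z hz
    rw [pointNrm, nrm_lt_iff hδ hXi hQ] at this
    exact ⟨this.1, this.2.1⟩
  have s1 := small c ⟨le_rfl, hcd⟩
  have s2 := small ((c + d) / 2) ⟨by linarith, by linarith⟩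
  by_cases hv1 : v.1 = 0
  · by_cases hv2 : v.2.1 = 0
    · have hv3 : v.2.2 ≠ 0 := fun h => hv (IntVec.ext' hv1 hv2 h)
      have h3 := one_le_abs_intCast hv3
      have := s1.1
      simp only [hv1, hv2] at this
      norm_num at this
      nlinarith
    · have h3 := one_le_abs_intCast hv2
      have := s1.2
      simp only [hv1, Int.cast_zero, zero_mul, sub_zero] at this
      nlinarith
  · have h3 := one_le_abs_intCast hv1
    have h4 : |(v.1 : ℝ) * ((d - c) / 2)| < 2 * (ρ * (δ * Q)⁻¹) := by
      have e : (v.1 : ℝ) * ((d - c) / 2) = (v.2.1 - v.1 * c) - (v.2.1 - v.1 * ((c + d) / 2)) := by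
        ring
      rw [e]
      refine (abs_sub _ _).trans_lt ?_
      linarith [s1.2, s2.2]
    rw [abs_mul, abs_of_pos (by linarith : 0 < (d - c) / 2)] at h4
    nlinarith

lemma CurveOn.exists_le_lineNrm {f f₁ f₂ : ℝ → ℝ} {c d K ρ δ Q : ℝ} (H : CurveOn f f₁ f₂ c d K)
    (hcd : c < d) (hρ1 : ρ ≤ 1) (hδ : 0 < δ) (hδ1 : δ ≤ 1) (hQ : 0 < Q)
    (h1 : 1 ≤ δ * Q) (h6 : 6 ≤ δ * Q * (d - c)) (h36 : 36 * K ≤ δ * Q * (d - c) ^ 2)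
    {a : IntVec} (ha : a ≠ (0, 0, 0)) :
    ∃ z ∈ Set.Ico c d, ρ ≤ lineNrm f f₁ Q⁻¹ (δ * Q)⁻¹⁻¹ δ⁻¹ a z := by
  by_contra! hcon
  have hX : 0 < δ * Q := by positivity
  have hK : 0 < K := zero_lt_one.trans_le H.one_le
  have hle : ρ * Q⁻¹ ≤ (δ * Q)⁻¹ := by
    have : Q⁻¹ ≤ (δ * Q)⁻¹ := inv_anti₀ hX (by nlinarith)
    nlinarith [inv_pos.2 hQ]
  set e := (δ * Q)⁻¹ with he
  have heX : e * (δ * Q) = 1 := inv_mul_cancel₀ hX.ne'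
  have he1 : e ≤ 1 := inv_le_one_of_one_le₀ h1
  have he0 : 0 < e := by positivity
  have small : ∀ z ∈ Set.Ico c d, |(a.1 : ℝ) + a.2.1 * z + a.2.2 * f z| < e := by
    intro z hz
    have := hcon z hz
    rw [lineNrm, nrm_lt_iff (by positivity) (by positivity) (by positivity)] at this
    exact this.1.trans_le hle
  set h := (d - c) / 3 with hh
  have hh0 : 0 < h := by rw [hh]; linarith
  have h2 : 2 * e ≤ h := by
    have : e * 6 ≤ e * (δ * Q * (d - c)) := mul_le_mul_of_nonneg_left h6 he0.le
    have e2 : e * (δ * Q * (d - c)) = d - c := by rw [← mul_assoc, heX, one_mul]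
    rw [hh]; linarith
  have h4 : 4 * e ≤ K⁻¹ * h * h := by
    have h5 : e * (36 * K) ≤ e * (δ * Q * (d - c) ^ 2) := mul_le_mul_of_nonneg_left h36 he0.le
    have e2 : e * (δ * Q * (d - c) ^ 2) = (d - c) ^ 2 := by rw [← mul_assoc, heX, one_mul]
    have : K⁻¹ * h * h = K⁻¹ * ((d - c) ^ 2 / 9) := by rw [hh]; ring
    rw [this, inv_mul_eq_div, le_div_iff₀ hK]
    linarith
  have s0 := small c ⟨le_rfl, hcd⟩
  have s1 := small (c + h) ⟨by linarith, by rw [hh]; linarith⟩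
  have s2 := small (c + h + h) ⟨by linarith, by rw [hh]; linarith⟩
  by_cases ha2 : a.2.2 = 0
  · simp only [ha2, Int.cast_zero, zero_mul, add_zero] at s0 s1 s2
    by_cases ha1 : a.2.1 = 0
    · have ha0 : a.1 ≠ 0 := fun h => ha (IntVec.ext' h ha1 ha2)
      have := one_le_abs_intCast ha0
      simp only [ha1, Int.cast_zero, zero_mul, add_zero] at s0
      linarith
    · have h3 := one_le_abs_intCast ha1
      have h5 : |(a.2.1 : ℝ) * h| < 2 * e := by
        have e1 : (a.2.1 : ℝ) * h = (a.1 + a.2.1 * (c + h)) - (a.1 + a.2.1 * c) := by ring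
        rw [e1]
        exact (abs_sub _ _).trans_lt (by linarith)
      rw [abs_mul, abs_of_pos hh0] at h5
      nlinarith
  · have h3 := one_le_abs_intCast ha2
    have mem : ∀ z ∈ Set.Icc c (c + h), z ∈ Set.Icc c d ∧ z + h ∈ Set.Icc c d := by
      intro z hz
      have : c + h + h ≤ d := by rw [hh]; linarith
      exact ⟨⟨hz.1, by linarith [hz.2]⟩, by linarith [hz.1], by linarith [hz.2]⟩
    obtain ⟨z, -, hz, hd⟩ := exists_mul_sub_of_hasDerivAt (φ := fun x => f (x + h) - f x)
      (φ' := fun x => f₁ (x + h) - f₁ x) (u := c) (v := c + h) (x := c) (y := c + h)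
      (fun z hz => (HasDerivAt.comp_add_const z h (H.deriv _ (mem z hz).2)).sub
        (H.deriv z (mem z hz).1)) ⟨le_rfl, by linarith⟩ ⟨by linarith, le_rfl⟩ (by linarith)
    have h5 := (H.slope (mem z hz).2 (mem z hz).1).1
    rw [add_sub_cancel_left, abs_of_pos hh0] at h5
    have h6 : |(a.2.2 : ℝ) * ((f₁ (z + h) - f₁ z) * h)| < 4 * e := by
      have e1 : (a.2.2 : ℝ) * ((f₁ (z + h) - f₁ z) * h) =
          (a.1 + a.2.1 * (c + h + h) + a.2.2 * f (c + h + h)) -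
          (a.1 + a.2.1 * (c + h) + a.2.2 * f (c + h)) -
          ((a.1 + a.2.1 * (c + h) + a.2.2 * f (c + h)) -
          (a.1 + a.2.1 * c + a.2.2 * f c)) := by
        simp only [add_sub_cancel_left] at hd
        linear_combination -(a.2.2 : ℝ) * hd
      rw [e1]
      refine (abs_sub _ _).trans_lt ?_
      have t1 := abs_sub (a.1 + a.2.1 * (c + h + h) + a.2.2 * f (c + h + h))
        (a.1 + a.2.1 * (c + h) + a.2.2 * f (c + h))
      have t2 := abs_sub (a.1 + a.2.1 * (c + h) + a.2.2 * f (c + h))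
        (a.1 + a.2.1 * c + a.2.2 * f c)
      linarith
    rw [abs_mul, abs_mul, abs_of_pos hh0] at h6
    have h7 : K⁻¹ * h * h ≤ |f₁ (z + h) - f₁ z| * h := mul_le_mul_of_nonneg_right h5 hh0.le
    have h8 : 0 ≤ |f₁ (z + h) - f₁ z| * h := by positivity
    nlinarith

/-- A box form of Dirichlet's theorem, by pigeonhole. -/
lemma exists_dirichlet (x α β : ℝ) {W G : ℝ} (hW : 0 < W) (hW1 : W ≤ 1) (hG : 0 < G)
    (hG1 : G ≤ 1) : ∃ v : IntVec, 0 < v.1 ∧ (v.1 : ℝ) ≤ 4 / (W * G) ∧ |(v.2.1 : ℝ) - v.1 * x| < W ∧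
      |v.1 * α - v.2.2 + β * (v.2.1 - v.1 * x)| < G := by
  have bins : ∀ {y E : ℝ}, 0 < E → E ≤ 1 → ⌊Int.fract y / E⌋₊ ∈ Finset.range ⌈1 / E⌉₊ := by
    intro y E hE hE1
    rw [Finset.mem_range, Nat.floor_lt (div_nonneg (Int.fract_nonneg _) hE.le)]
    exact (div_lt_div_of_pos_right (Int.fract_lt_one _) hE).trans_le (Nat.le_ceil _)
  have near : ∀ {y z E : ℝ}, 0 < E → ⌊Int.fract y / E⌋₊ = ⌊Int.fract z / E⌋₊ →
      |Int.fract y - Int.fract z| < E := by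
    intro y z E hE h
    have hy := div_nonneg (Int.fract_nonneg y) hE.le
    have hz := div_nonneg (Int.fract_nonneg z) hE.le
    have a1 := Nat.floor_le hy
    have a2 := Nat.lt_floor_add_one (Int.fract y / E)
    have b1 := Nat.floor_le hz
    have b2 := Nat.lt_floor_add_one (Int.fract z / E)
    rw [h] at a1 a2
    have : |Int.fract y / E - Int.fract z / E| < 1 := by
      rw [abs_lt]; constructor <;> linarith
    rwa [← sub_div, abs_div, abs_of_pos hE, div_lt_one hE] at this
  set n₁ := ⌈1 / W⌉₊
  set n₂ := ⌈1 / G⌉₊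
  have ceil_le : ∀ {E : ℝ}, 0 < E → E ≤ 1 → (⌈1 / E⌉₊ : ℝ) ≤ 2 / E := by
    intro E hE hE1
    have h1 := (Nat.ceil_lt_add_one (show (0 : ℝ) ≤ 1 / E by positivity)).le
    have h2 : 1 ≤ 1 / E := by rw [le_div_iff₀ hE]; linarith
    have h3 : 2 / E = 1 / E + 1 / E := by ring
    linarith
  let y : ℕ → ℝ := fun q => q * α - β * Int.fract (q * x)
  obtain ⟨q, hq, q', hq', hne, heq⟩ := Finset.exists_ne_map_eq_of_card_lt_of_maps_to
    (s := Finset.range (n₁ * n₂ + 1)) (t := Finset.range n₁ ×ˢ Finset.range n₂)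
    (f := fun q : ℕ => (⌊Int.fract (q * x) / W⌋₊, ⌊Int.fract (y q) / G⌋₊)) (by simp)
    (fun q _ => Finset.mem_coe.2 (Finset.mem_product.2 ⟨bins hW hW1, bins hG hG1⟩))
  wlog hlt : q' < q generalizing q q'
  · exact this q' hq' q hq hne.symm heq.symm (lt_of_le_of_ne (not_lt.1 hlt) hne)
  simp only [Prod.mk.injEq] at heq
  refine ⟨((q : ℤ) - q', ⌊(q : ℝ) * x⌋ - ⌊(q' : ℝ) * x⌋, ⌊y q⌋ - ⌊y q'⌋), ?_, ?_, ?_, ?_⟩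
  · simpa using hlt
  · have h1 : (q : ℝ) ≤ n₁ * n₂ := by
      have := Finset.mem_range.1 hq
      exact_mod_cast Nat.lt_succ_iff.1 this
    have h2 : (n₁ : ℝ) * n₂ ≤ (2 / W) * (2 / G) :=
      mul_le_mul (ceil_le hW hW1) (ceil_le hG hG1) (by positivity) (by positivity)
    have h3 : (2 / W) * (2 / G) = 4 / (W * G) := by field_simp; norm_num
    push_cast
    linarith [(Nat.cast_nonneg q' : (0 : ℝ) ≤ q')]
  · have := near hW heq.1
    rw [abs_sub_comm] at this
    convert this using 2
    simp only [Int.fract]; push_cast; ring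
  · have := near hG heq.2
    convert this using 2
    simp only [y, Int.fract]; push_cast; ring

/-- The reals near the first coordinate of a rational point of height about `Q` near the curve. -/
def NearRational (f : ℝ → ℝ) (u v κ Q δ x : ℝ) : Prop :=
  ∃ q p₁ p₂ : ℤ, κ * Q ≤ q ∧ q ≤ 4 * Q / κ ^ 2 ∧ (p₁ / q : ℝ) ∈ Set.Icc u v ∧
    |x - p₁ / q| < (δ * Q ^ 2)⁻¹ ∧ |q * f (p₁ / q) - p₂| ≤ 2 * κ * δ

lemma CurveOn.nearRational {f f₁ f₂ : ℝ → ℝ} {u v a b K κ Q δ x : ℝ}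
    (H : CurveOn f f₁ f₂ u v K) (hκ : 0 < κ) (hκ1 : κ ≤ 1) (hδ : 0 < δ) (hδ1 : δ ≤ 1)
    (hKQ : K ≤ δ * Q) (hua : (δ * Q)⁻¹ ≤ a - u) (hbv : (δ * Q)⁻¹ ≤ v - b) (hx : x ∈ Set.Ico a b)
    (hlarge : ¬ ∃ w : IntVec, w.IsPrimitive ∧ pointNrm f f₁ δ (δ * Q)⁻¹ Q w x < κ) :
    NearRational f u v κ Q δ x := by
  have hX1 : 1 ≤ δ * Q := H.one_le.trans hKQ
  have hX : 0 < δ * Q := by linarith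
  have hQ : 0 < Q := by
    by_contra! h
    nlinarith
  have hXi1 : (δ * Q)⁻¹ ≤ 1 := inv_le_one_of_one_le₀ hX1
  have hXi : 0 < (δ * Q)⁻¹ := by positivity
  obtain ⟨w, hw0, hw4, hw1, hw2⟩ := exists_dirichlet x (f x) (f₁ x)
    (W := κ * (δ * Q)⁻¹) (G := κ * δ) (by positivity) (by nlinarith) (by positivity) (by nlinarith)
  have hwne : w ≠ (0, 0, 0) := by
    rintro rfl
    simp at hw0
  have hq : (0 : ℝ) < w.1 := by exact_mod_cast hw0
  have hqlo : κ * Q ≤ w.1 := by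
    by_contra! hlt
    obtain ⟨m, hm, w', hw', rfl⟩ := IntVec.exists_scale_isPrimitive hwne
    refine hlarge ⟨w', hw', (pointNrm_le_scale hδ hXi hQ hm w' x).trans_lt ?_⟩
    rw [pointNrm, nrm_lt_iff hδ hXi hQ]
    exact ⟨hw2, hw1, by rwa [abs_of_pos hq]⟩
  have hκQ : 0 < κ * Q := by positivity
  set y : ℝ := w.2.1 / w.1 with hy
  have hyq : (w.2.1 : ℝ) - w.1 * x = w.1 * (y - x) := by rw [hy]; field_simp
  rw [hyq] at hw1 hw2
  rw [abs_mul, abs_of_pos hq] at hw1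
  have hxy : |y - x| < (δ * Q ^ 2)⁻¹ := by
    have h1 : κ * Q * |y - x| < κ * (δ * Q)⁻¹ :=
      (mul_le_mul_of_nonneg_right hqlo (abs_nonneg _)).trans_lt hw1
    have h2 : κ * (δ * Q)⁻¹ = κ * Q * (δ * Q ^ 2)⁻¹ := by field_simp
    rw [h2] at h1
    exact lt_of_mul_lt_mul_left h1 hκQ.le
  have hsm : (δ * Q ^ 2)⁻¹ ≤ (δ * Q)⁻¹ := by
    refine inv_anti₀ hX ?_
    nlinarith
  have hyuv : y ∈ Set.Icc u v := by
    have := abs_lt.1 hxy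
    exact ⟨by linarith [hx.1, this.1], by linarith [hx.2, this.2]⟩
  have hxuv : x ∈ Set.Icc u v := ⟨by linarith [hx.1], by linarith [hx.2]⟩
  refine ⟨w.1, w.2.1, w.2.2, hqlo, ?_, hyuv, by rwa [abs_sub_comm], ?_⟩
  · refine hw4.trans_eq ?_
    field_simp
  · have ht := H.taylor hxuv hyuv
    have h1 : (w.1 : ℝ) * f y - w.2.2 = w.1 * (f y - f x - f₁ x * (y - x)) +
        (w.1 * f x - w.2.2 + f₁ x * (w.1 * (y - x))) := by ring
    have h2 : |(w.1 : ℝ) * (f y - f x - f₁ x * (y - x))| ≤ κ * δ := by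
      rw [abs_mul, abs_of_pos hq]
      calc (w.1 : ℝ) * |f y - f x - f₁ x * (y - x)| ≤ w.1 * (K * |y - x| ^ 2) := by gcongr
        _ = K * (w.1 * |y - x|) * |y - x| := by ring
        _ ≤ (δ * Q) * (κ * (δ * Q)⁻¹) * (δ * Q ^ 2)⁻¹ := by gcongr
        _ = κ * (δ * Q ^ 2)⁻¹ := by field_simp
        _ ≤ κ * δ := by
          gcongr
          rw [inv_le_comm₀ (by positivity) hδ]
          have : δ⁻¹ ≤ δ⁻¹ * (δ * Q) ^ 2 := le_mul_of_one_le_right (by positivity) (by nlinarith)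
          refine this.trans_eq ?_
          field_simp
    rw [h1]
    calc _ ≤ _ := abs_add_le _ _
      _ ≤ 2 * κ * δ := by linarith

/-- Most of any interior interval is near rational points close to the curve. -/
theorem CurveOn.exists_volume_nearRational_ge {f f₁ f₂ : ℝ → ℝ} {u v a b K : ℝ}
    (H : CurveOn f f₁ f₂ u v K) (hua : u < a) (hab : a < b) (hbv : b < v) :
    ∃ κ Q₀ : ℝ, 0 < κ ∧ κ ≤ 1 / 8 ∧ ∀ Q δ : ℝ, 0 < δ → δ ≤ 1 → Q₀ ≤ δ * Q →
      ENNReal.ofReal ((b - a) / 2) ≤ volume {x ∈ Set.Ico a b | NearRational f u v κ Q δ x} := by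
  have hK := H.one_le
  have hK4 : 1 ≤ K ^ 4 := one_le_pow₀ hK
  obtain ⟨ρ, hρ⟩ : ∃ ρ, 2 * (4 * (343 * K ^ 4) + 1) * ρ = 1 :=
    ⟨_, mul_inv_cancel₀ (by positivity)⟩
  have hρ0 : 0 < ρ := pos_of_mul_pos_right (a := 2 * (4 * (343 * K ^ 4) + 1))
    (by rw [hρ]; exact one_pos) (by positivity)
  have hρ1 : ρ ≤ 1 := by nlinarith
  have hden : 1 ≤ 16 * (343 * K ^ 4) := by linarith
  set κ := ρ / (16 * (343 * K ^ 4)) with hκ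
  have hκ0 : 0 < κ := by positivity
  have hκρ : κ ≤ ρ := div_le_self hρ0.le hden
  have hκ8 : κ ≤ 1 / 8 := by
    rw [hκ, div_le_iff₀ (by positivity)]; linarith
  have hsqrt : 2 * √(343 * K ^ 4 * κ / ρ) = 1 / 2 := by
    have : 343 * K ^ 4 * κ / ρ = (1 / 4) ^ 2 := by rw [hκ]; field_simp; norm_num
    rw [this, Real.sqrt_sq (by norm_num)]
    norm_num
  refine ⟨κ, K + 6 / (b - a) + 36 * K / (b - a) ^ 2 + (a - u)⁻¹ + (v - b)⁻¹, hκ0, hκ8, ?_⟩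
  intro Q δ hδ hδ1 hQ0
  have hab' : 0 < b - a := by linarith
  have hua' : 0 < a - u := by linarith
  have hbv' : 0 < v - b := by linarith
  have p1 : 0 ≤ 6 / (b - a) := by positivity
  have p2 : 0 ≤ 36 * K / (b - a) ^ 2 := by positivity
  have p3 : 0 ≤ (a - u)⁻¹ := by positivity
  have p4 : 0 ≤ (v - b)⁻¹ := by positivity
  have hKQ : K ≤ δ * Q := by linarith
  have hX1 : 1 ≤ δ * Q := hK.trans hKQ
  have hX : 0 < δ * Q := by linarith
  have hQ : 0 < Q := pos_of_mul_pos_right hX hδ.le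
  have h6 : 6 ≤ δ * Q * (b - a) := by
    rw [← div_le_iff₀ hab']; linarith
  have h36 : 36 * K ≤ δ * Q * (b - a) ^ 2 := by
    rw [← div_le_iff₀ (by positivity)]; linarith
  have bad := (H.mono hua.le hbv.le).volume_exists_pointNrm_lt_le hab (A := δ) (B := (δ * Q)⁻¹)
    (D := Q) hδ (by positivity) hQ (by field_simp) hκ0 hκρ hρ
    (fun w hw => exists_le_pointNrm hab hρ0 hρ1 hδ hδ1 hQ hX1 h6 hw.ne_zero)
    (fun w hw => (H.mono hua.le hbv.le).exists_le_lineNrm hab hρ1 hδ hδ1 hQ hX1 h6 h36 hw.ne_zero)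
  rw [hsqrt] at bad
  have cover : volume (Set.Ico a b) ≤
      volume {x ∈ Set.Ico a b | NearRational f u v κ Q δ x} +
      volume {x ∈ Set.Ico a b |
        ∃ w : IntVec, w.IsPrimitive ∧ pointNrm f f₁ δ (δ * Q)⁻¹ Q w x < κ} := by
    refine (measure_mono ?_).trans (measure_union_le _ _)
    intro x hx
    by_cases hbad : ∃ w : IntVec, w.IsPrimitive ∧ pointNrm f f₁ δ (δ * Q)⁻¹ Q w x < κ
    · exact Or.inr ⟨hx, hbad⟩
    · refine Or.inl ⟨hx, H.nearRational hκ0 (by linarith) hδ hδ1 hKQ ?_ ?_ hx hbad⟩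
      · rw [inv_le_comm₀ hX hua']; linarith
      · rw [inv_le_comm₀ hX hbv']; linarith
  rw [Real.volume_Ico] at cover
  have e : ENNReal.ofReal (b - a) =
      ENNReal.ofReal ((b - a) / 2) + ENNReal.ofReal (1 / 2 * (b - a)) := by
    rw [← ENNReal.ofReal_add (by linarith) (by linarith)]; congr 1; ring
  rw [e] at cover
  exact (ENNReal.add_le_add_iff_right ENNReal.ofReal_ne_top).1
    (cover.trans (add_le_add_right bad _))

/-- A second-moment lower bound for the measure of a finite union. -/
lemma sq_sum_measureReal_le {α ι : Type*} [MeasurableSpace α] {μ : Measure α} {J : Finset ι}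
    {E : ι → Set α} (hE : ∀ j ∈ J, MeasurableSet (E j)) (hfin : ∀ j ∈ J, μ (E j) ≠ ⊤) :
    (∑ j ∈ J, μ.real (E j)) ^ 2 ≤
      μ.real (⋃ j ∈ J, E j) * ∑ i ∈ J, ∑ j ∈ J, μ.real (E i ∩ E j) := by
  classical
  set U := ⋃ j ∈ J, E j with hU
  have hUm : MeasurableSet U := Finset.measurableSet_biUnion J hE
  have hUfin : μ U ≠ ⊤ := (measure_biUnion_lt_top J.finite_toSet
    (fun j hj => (hfin j hj).lt_top)).ne
  have one : ∀ S : Set α, MeasurableSet S → μ S ≠ ⊤ →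
      Integrable (S.indicator (fun _ => (1 : ℝ))) μ ∧
      ∫ x, S.indicator (fun _ => (1 : ℝ)) x ∂μ = μ.real S := by
    intro S hS hSf
    refine ⟨(integrable_indicator_iff hS).2 (integrableOn_const hSf), ?_⟩
    rw [integral_indicator hS]
    simp [Measure.real]
  set χ : Set α → α → ℝ := fun S => S.indicator (fun _ => 1) with hχ
  have hmul : ∀ S S' : Set α, ∀ x, χ S x * χ S' x = χ (S ∩ S') x := by
    intro S S' x
    simp only [hχ, Set.indicator_apply, Set.mem_inter_iff]
    split_ifs <;> simp_all
  set m := ∑ j ∈ J, μ.real (E j) with hm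
  set M := ∑ i ∈ J, ∑ j ∈ J, μ.real (E i ∩ E j) with hM
  have hEE : ∀ i ∈ J, ∀ j ∈ J, Integrable (χ (E i ∩ E j)) μ ∧
      ∫ x, χ (E i ∩ E j) x ∂μ = μ.real (E i ∩ E j) := fun i hi j hj =>
    one _ ((hE i hi).inter (hE j hj)) (measure_ne_top_of_subset Set.inter_subset_left (hfin i hi))
  have quad : ∀ c : ℝ, 0 ≤ μ.real U * (c * c) + (-2 * m) * c + M := by
    intro c
    have hpt : ∀ x, (∑ j ∈ J, χ (E j) x - c * χ U x) ^ 2 =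
        ∑ i ∈ J, ∑ j ∈ J, χ (E i ∩ E j) x - 2 * c * ∑ j ∈ J, χ (E j) x + c * c * χ U x := by
      intro x
      have h1 : ∑ i ∈ J, ∑ j ∈ J, χ (E i ∩ E j) x = (∑ j ∈ J, χ (E j) x) ^ 2 := by
        rw [sq, Finset.sum_mul_sum]; simp_rw [hmul]
      have h2 : (∑ j ∈ J, χ (E j) x) * χ U x = ∑ j ∈ J, χ (E j) x := by
        rw [Finset.sum_mul]
        refine Finset.sum_congr rfl fun j hj => ?_
        rw [hmul, Set.inter_eq_left.2 (show E j ⊆ U from fun y hy => Set.mem_biUnion hj hy)]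
      have h3 : χ U x * χ U x = χ U x := by rw [hmul, Set.inter_self]
      rw [h1]
      linear_combination -2 * c * h2 + c * c * h3
    have h_nonneg : 0 ≤ ∫ x, (∑ j ∈ J, χ (E j) x - c * χ U x) ^ 2 ∂μ :=
      integral_nonneg fun x => sq_nonneg _
    simp_rw [hpt] at h_nonneg
    have i1 : Integrable (fun x => ∑ i ∈ J, ∑ j ∈ J, χ (E i ∩ E j) x) μ :=
      integrable_finsetSum _ fun i hi => integrable_finsetSum _ fun j hj => (hEE i hi j hj).1
    have i2 : Integrable (fun x => ∑ j ∈ J, χ (E j) x) μ :=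
      integrable_finsetSum _ fun j hj => (one _ (hE j hj) (hfin j hj)).1
    have i3 : Integrable (χ U) μ := (one U hUm hUfin).1
    have e1 : ∫ x, ∑ i ∈ J, ∑ j ∈ J, χ (E i ∩ E j) x ∂μ = M := by
      rw [integral_finsetSum _ fun i hi => integrable_finsetSum _ fun j hj => (hEE i hi j hj).1]
      refine Finset.sum_congr rfl fun i hi => ?_
      rw [integral_finsetSum _ fun j hj => (hEE i hi j hj).1]
      exact Finset.sum_congr rfl fun j hj => (hEE i hi j hj).2
    have e2 : ∫ x, ∑ j ∈ J, χ (E j) x ∂μ = m := by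
      rw [integral_finsetSum _ fun j hj => (one _ (hE j hj) (hfin j hj)).1]
      exact Finset.sum_congr rfl fun j hj => (one _ (hE j hj) (hfin j hj)).2
    have e3 : ∫ x, χ U x ∂μ = μ.real U := (one U hUm hUfin).2
    have e4 := integral_add (i1.sub (i2.const_mul (2 * c))) (i3.const_mul (c * c))
    have e5 := integral_sub i1 (i2.const_mul (2 * c))
    simp only [Pi.sub_apply] at e4 e5
    rw [e4, e5, integral_const_mul, integral_const_mul, e1, e2, e3] at h_nonneg
    linarith
  have := discrim_le_zero quad
  rw [discrim] at this
  nlinarith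

lemma card_le_of_abs_sub_lt {X : Finset ℕ} {c ρ : ℝ} (hρ : 0 ≤ ρ)
    (h : ∀ k ∈ X, |(k : ℝ) - c| < ρ) : (X.card : ℝ) ≤ 2 * ρ + 1 := by
  rcases X.eq_empty_or_nonempty with rfl | hX
  · simp; linarith
  · have hsub : X ⊆ Finset.Icc (X.min' hX) (X.max' hX) := fun k hk =>
      Finset.mem_Icc.2 ⟨X.min'_le k hk, X.le_max' k hk⟩
    have hle : X.min' hX ≤ X.max' hX := X.min'_le_max' hX
    have h1 := Finset.card_le_card hsub
    rw [Nat.card_Icc] at h1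
    have h2 : X.card + X.min' hX ≤ X.max' hX + 1 := by omega
    have h3 : (X.card : ℝ) + X.min' hX ≤ X.max' hX + 1 := by exact_mod_cast h2
    have h4 := abs_lt.1 (h _ (X.min'_mem hX))
    have h5 := abs_lt.1 (h _ (X.max'_mem hX))
    linarith [h4.1, h5.2]

/-- Choosing one centre for each cell of a grid of mesh `r` met by the `r`-neighbourhood of `R`. -/
lemma exists_grid_centres {a b r : ℝ} {R : Set ℝ} (hr : 0 < r)
    (hvol : ENNReal.ofReal ((b - a) / 2) ≤ volume {x ∈ Set.Ico a b | ∃ ξ ∈ R, |x - ξ| < r}) :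
    ∃ (X : Finset ℕ) (ξ : ℕ → ℝ), (∀ k ∈ X, ξ k ∈ R ∧ |ξ k - (a + k * r)| < 2 * r ∧
      k < ⌈(b - a) / r⌉₊) ∧ (b - a) / 2 ≤ X.card * r := by
  classical
  set X := (Finset.range ⌈(b - a) / r⌉₊).filter
    (fun k : ℕ => ∃ ξ ∈ R, |ξ - (a + k * r)| < 2 * r) with hX
  have hch : ∀ k ∈ X, ∃ ξ ∈ R, |ξ - (a + k * r)| < 2 * r := fun k hk => (Finset.mem_filter.1 hk).2
  choose! ξ hξ hξd using hch
  refine ⟨X, ξ, fun k hk => ⟨hξ k hk, hξd k hk,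
    Finset.mem_range.1 (Finset.mem_filter.1 hk).1⟩, ?_⟩
  have hsub : {x ∈ Set.Ico a b | ∃ ξ ∈ R, |x - ξ| < r} ⊆
      ⋃ k ∈ X, Set.Ico (a + k * r) (a + k * r + r) := by
    rintro x ⟨⟨hxa, hxb⟩, z, hz, hxz⟩
    have h0 : 0 ≤ (x - a) / r := div_nonneg (by linarith) hr.le
    have h1 := (le_div_iff₀ hr).1 (Nat.floor_le h0)
    have h2 := (div_lt_iff₀ hr).1 (Nat.lt_floor_add_one ((x - a) / r))
    set k := ⌊(x - a) / r⌋₊ with hk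
    refine Set.mem_biUnion (x := k) ?_ ⟨by linarith, by linarith⟩
    refine Finset.mem_coe.2 (Finset.mem_filter.2 ⟨Finset.mem_range.2 ?_, z, hz, ?_⟩)
    · rw [hk, Nat.floor_lt h0]
      exact (div_lt_div_of_pos_right (by linarith) hr).trans_le (Nat.le_ceil _)
    · have := abs_lt.1 hxz
      rw [abs_lt]; constructor <;> linarith [this.1, this.2]
  have h1 := hvol.trans ((measure_mono hsub).trans (measure_biUnion_finset_le _ _))
  simp only [Real.volume_Ico, add_sub_cancel_left, Finset.sum_const, nsmul_eq_mul] at h1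
  rw [← ENNReal.ofReal_natCast, ← ENNReal.ofReal_mul (by positivity)] at h1
  exact (ENNReal.ofReal_le_ofReal_iff (by positivity)).1 h1

lemma sum_filter_le_of_halving {s : ℕ → ℝ} (hs : ∀ t, 0 < s t) (hhalf : ∀ t, s (t + 1) ≤ s t / 2)
    (F : Finset ℕ) (n : ℕ) : ∑ t ∈ F with n ≤ t, s t ≤ 2 * s n := by
  obtain ⟨N, hN⟩ := F.exists_nat_subset_range
  have h1 : ∑ t ∈ F with n ≤ t, s t ≤ ∑ t ∈ Finset.Ico n (n + N), s t := by
    refine Finset.sum_le_sum_of_subset_of_nonneg ?_ fun t _ _ => (hs t).le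
    intro t ht
    rw [Finset.mem_filter] at ht
    have := Finset.mem_range.1 (hN ht.1)
    exact Finset.mem_Ico.2 ⟨ht.2, by omega⟩
  have h2 : ∀ N : ℕ, ∑ t ∈ Finset.Ico n (n + N), s t ≤ 2 * s n - 2 * s (n + N) := by
    intro N
    induction N with
    | zero => simp
    | succ N ih =>
      rw [← add_assoc, Finset.sum_Ico_succ_top (by omega)]
      linarith [hhalf (n + N)]
  linarith [h2 N, hs (n + N)]

lemma antitone_of_halving {s : ℕ → ℝ} (hs : ∀ t, 0 < s t) (hhalf : ∀ t, s (t + 1) ≤ s t / 2) :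
    Antitone s :=
  antitone_nat_of_succ_le fun t => (hhalf t).trans (by linarith [hs t])

/-- Correlation of the balls of two levels of a grid system. -/
lemma sum_measureReal_inter_ball_le {a b r r' s s' : ℝ} {X X' : Finset ℕ} {ξ ξ' : ℕ → ℝ}
    (hr : 0 < r) (hr' : 0 < r') (hrb : r ≤ b - a) (hs' : 0 < s') (hss : s' ≤ s)
    (hX : ∀ k ∈ X, k < ⌈(b - a) / r⌉₊) (hX' : ∀ k ∈ X', |ξ' k - (a + k * r')| < 2 * r') :
    ∑ i ∈ X, ∑ j ∈ X', volume.real (Metric.ball (ξ i) s ∩ Metric.ball (ξ' j) s') ≤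
      16 * (b - a) * (s / r) * (s' / r') + 20 * (b - a) / r * s' := by
  classical
  have hs : 0 < s := hs'.trans_le hss
  have hcard : (X.card : ℝ) ≤ 2 * (b - a) / r := by
    have h1 : X ⊆ Finset.range ⌈(b - a) / r⌉₊ := fun k hk => Finset.mem_range.2 (hX k hk)
    have h2 := Finset.card_le_card h1
    rw [Finset.card_range] at h2
    have h3 : (X.card : ℝ) ≤ ⌈(b - a) / r⌉₊ := by exact_mod_cast h2
    have h4 := Nat.ceil_lt_add_one (show 0 ≤ (b - a) / r by apply div_nonneg <;> linarith)
    have h5 : 1 ≤ (b - a) / r := by rw [le_div_iff₀ hr]; linarith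
    have h6 : 2 * (b - a) / r = (b - a) / r + (b - a) / r := by ring
    linarith
  have inner : ∀ i ∈ X, ∑ j ∈ X', volume.real (Metric.ball (ξ i) s ∩ Metric.ball (ξ' j) s') ≤
      (4 * s / r' + 5) * (2 * s') := by
    intro i _
    set Y := X'.filter (fun j => |ξ' j - ξ i| < 2 * s)
    have hY : (Y.card : ℝ) ≤ 4 * s / r' + 5 := by
      have h1 : ∀ j ∈ Y, |(j : ℝ) - (ξ i - a) / r'| < 2 * s / r' + 2 := by
        intro j hj
        obtain ⟨hj, hj2⟩ := Finset.mem_filter.1 hj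
        have e : (j : ℝ) - (ξ i - a) / r' = ((ξ' j - ξ i) - (ξ' j - (a + j * r'))) / r' := by
          field_simp; ring
        rw [e, abs_div, abs_of_pos hr', div_lt_iff₀ hr', add_mul, div_mul_cancel₀ _ hr'.ne']
        exact (abs_sub _ _).trans_lt (add_lt_add hj2 (hX' j hj))
      refine (card_le_of_abs_sub_lt (by positivity) h1).trans_eq ?_
      ring
    have hz : ∀ j ∈ X', volume.real (Metric.ball (ξ i) s ∩ Metric.ball (ξ' j) s') ≤
        if |ξ' j - ξ i| < 2 * s then 2 * s' else 0 := by
      intro j _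
      split_ifs with h
      · refine (measureReal_mono Set.inter_subset_right measure_ball_lt_top.ne).trans_eq ?_
        rw [Measure.real, Real.volume_ball, ENNReal.toReal_ofReal (by positivity)]
      · have : Metric.ball (ξ i) s ∩ Metric.ball (ξ' j) s' = ∅ := by
          rw [← Set.disjoint_iff_inter_eq_empty]
          refine Metric.ball_disjoint_ball ?_
          rw [dist_comm, Real.dist_eq]
          linarith [not_lt.1 h]
        rw [this]; simp
    refine (Finset.sum_le_sum hz).trans ?_
    rw [← Finset.sum_filter, Finset.sum_const, nsmul_eq_mul]
    gcongr
  refine (Finset.sum_le_sum inner).trans ?_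
  rw [Finset.sum_const, nsmul_eq_mul]
  calc (X.card : ℝ) * ((4 * s / r' + 5) * (2 * s'))
      ≤ 2 * (b - a) / r * ((4 * s / r' + 5) * (2 * s')) := by gcongr
    _ = _ := by ring

theorem le_measureReal_biUnion_ball {a b : ℝ} {F : Finset ℕ} {r s : ℕ → ℝ} {X : ℕ → Finset ℕ}
    {ξ : ℕ → ℕ → ℝ} (hab : a < b) (hr : ∀ t ∈ F, 0 < r t) (hrb : ∀ t ∈ F, r t ≤ b - a)
    (hs : ∀ t, 0 < s t) (hhalf : ∀ t, s (t + 1) ≤ s t / 2)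
    (hX : ∀ t ∈ F, ∀ k ∈ X t, |ξ t k - (a + k * r t)| < 2 * r t ∧ k < ⌈(b - a) / r t⌉₊)
    (hcard : ∀ t ∈ F, (b - a) / 2 ≤ (X t).card * r t) (hW : 1 ≤ ∑ t ∈ F, s t / r t) :
    (b - a) / 112 ≤ volume.real (⋃ t ∈ F, ⋃ k ∈ X t, Metric.ball (ξ t k) (s t)) := by
  classical
  set W := ∑ t ∈ F, s t / r t with hWdef
  have hl : 0 < b - a := by linarith
  have CS := sq_sum_measureReal_le (μ := volume) (J := F.sigma X)
    (E := fun p : (_ : ℕ) × ℕ => Metric.ball (ξ p.1 p.2) (s p.1))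
    (fun _ _ => Metric.isOpen_ball.measurableSet) (fun _ _ => measure_ball_lt_top.ne)
  have hU : (⋃ p ∈ F.sigma X, Metric.ball (ξ p.1 p.2) (s p.1)) =
      ⋃ t ∈ F, ⋃ k ∈ X t, Metric.ball (ξ t k) (s t) := by
    ext y
    simp only [Set.mem_iUnion, Finset.mem_sigma, Sigma.exists, exists_prop, and_assoc]
    exact exists_congr fun t => by simp only [exists_and_left]
  rw [hU] at CS
  simp only [Finset.sum_sigma] at CS
  set U := ⋃ t ∈ F, ⋃ k ∈ X t, Metric.ball (ξ t k) (s t)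
  have h1 : (b - a) * W ≤ ∑ t ∈ F, ∑ k ∈ X t, volume.real (Metric.ball (ξ t k) (s t)) := by
    rw [hWdef, Finset.mul_sum]
    refine Finset.sum_le_sum fun t ht => ?_
    have e : ∀ k ∈ X t, volume.real (Metric.ball (ξ t k) (s t)) = 2 * s t := by
      intro k _
      rw [Measure.real, Real.volume_ball, ENNReal.toReal_ofReal (by linarith [hs t])]
    rw [Finset.sum_congr rfl e, Finset.sum_const, nsmul_eq_mul, ← mul_div_assoc,
      div_le_iff₀ (hr t ht)]
    nlinarith [hcard t ht, hs t]
  set P : ℕ → ℕ → ℝ := fun t t' => ∑ i ∈ X t, ∑ j ∈ X t',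
    volume.real (Metric.ball (ξ t i) (s t) ∩ Metric.ball (ξ t' j) (s t')) with hP
  have hPsymm : ∀ t t', P t t' = P t' t := by
    intro t t'
    simp only [hP]
    rw [Finset.sum_comm]
    simp only [Set.inter_comm]
  have hPnn : ∀ t t', 0 ≤ P t t' := fun t t' =>
    Finset.sum_nonneg fun _ _ => Finset.sum_nonneg fun _ _ => measureReal_nonneg
  have hPle : ∀ t ∈ F, ∑ t' ∈ F with t ≤ t', P t t' ≤
      16 * (b - a) * (s t / r t) * W + 40 * (b - a) * (s t / r t) := by
    intro t ht
    have hrt := hr t ht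
    have hb : ∀ t' ∈ F.filter (fun t' => t ≤ t'), P t t' ≤
        16 * (b - a) * (s t / r t) * (s t' / r t') + 20 * (b - a) / r t * s t' := by
      intro t' ht'
      obtain ⟨hF', hle⟩ := Finset.mem_filter.1 ht'
      exact sum_measureReal_inter_ball_le hrt (hr t' hF') (hrb t ht) (hs t')
        (antitone_of_halving hs hhalf hle) (fun k hk => (hX t ht k hk).2)
        (fun k hk => (hX t' hF' k hk).1)
    refine (Finset.sum_le_sum hb).trans ?_
    rw [Finset.sum_add_distrib, ← Finset.mul_sum, ← Finset.mul_sum]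
    have g1 : ∑ t' ∈ F with t ≤ t', s t' / r t' ≤ W :=
      Finset.sum_le_sum_of_subset_of_nonneg (Finset.filter_subset _ _)
        fun i hi _ => (div_pos (hs i) (hr i hi)).le
    have g2 := sum_filter_le_of_halving hs hhalf F t
    have hst := hs t
    calc _ ≤ 16 * (b - a) * (s t / r t) * W + 20 * (b - a) / r t * (2 * s t) := by gcongr
      _ = _ := by ring
  have h2 : ∑ t ∈ F, ∑ t' ∈ F, P t t' ≤ 112 * (b - a) * W ^ 2 := by
    have g1 : ∑ t ∈ F, ∑ t' ∈ F, P t t' ≤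
        ∑ t ∈ F, ∑ t' ∈ F, ((if t ≤ t' then P t t' else 0) + if t' ≤ t then P t' t else 0) := by
      refine Finset.sum_le_sum fun t _ => Finset.sum_le_sum fun t' _ => ?_
      rcases le_total t t' with h | h
      · rw [if_pos h]
        have : 0 ≤ if t' ≤ t then P t' t else 0 := by split_ifs <;> simp [hPnn]
        linarith
      · rw [if_pos h, hPsymm]
        have : 0 ≤ if t ≤ t' then P t' t else 0 := by split_ifs <;> simp [hPnn]
        linarith
    simp only [Finset.sum_add_distrib] at g1
    rw [Finset.sum_comm (f := fun t t' => if t' ≤ t then P t' t else 0)] at g1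
    simp only [← Finset.sum_filter] at g1
    have g2 := Finset.sum_le_sum hPle
    rw [Finset.sum_add_distrib, ← Finset.sum_mul, ← Finset.mul_sum, ← Finset.mul_sum,
      ← hWdef] at g2
    have g3 : (b - a) * W ≤ (b - a) * W ^ 2 := by
      refine mul_le_mul_of_nonneg_left ?_ hl.le
      nlinarith
    nlinarith
  have h3 : ∑ t ∈ F, ∑ k ∈ X t, ∑ t' ∈ F, ∑ k' ∈ X t',
      volume.real (Metric.ball (ξ t k) (s t) ∩ Metric.ball (ξ t' k') (s t')) ≤
      112 * (b - a) * W ^ 2 := by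
    refine le_trans (le_of_eq ?_) h2
    refine Finset.sum_congr rfl fun t _ => ?_
    rw [Finset.sum_comm]
  have hUnn : 0 ≤ volume.real U := measureReal_nonneg
  have h4 : ((b - a) * W) ^ 2 ≤ volume.real U * (112 * (b - a) * W ^ 2) :=
    (pow_le_pow_left₀ (by positivity) h1 2).trans
      (CS.trans (mul_le_mul_of_nonneg_left h3 hUnn))
  rw [div_le_iff₀ (by norm_num)]
  have hc : 0 < (b - a) * W ^ 2 := by positivity
  refine le_of_mul_le_mul_right ?_ hc
  nlinarith

/-- A ubiquity principle: if the `r t`-neighbourhoods of `R t` fill half of `[a, b)` for `t ∈ T` and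
`∑ s t / r t` diverges over `T`, then the limsup set of the `s t`-neighbourhoods fills a fixed
proportion of `[a, b]`. -/
theorem exists_limsup_set {a b : ℝ} {r s : ℕ → ℝ} {R : ℕ → Set ℝ} {T : Set ℕ} (hab : a < b)
    (hr : ∀ t, 0 < r t) (hs : ∀ t, 0 < s t) (hhalf : ∀ t, s (t + 1) ≤ s t / 2)
    (hsr : ∀ t, s t ≤ r t) (hrb : ∀ t ∈ T, r t ≤ b - a)
    (hr0 : ∀ ε > 0, ∃ n, ∀ t ∈ T, n ≤ t → r t < ε)
    (hvol : ∀ t ∈ T, ENNReal.ofReal ((b - a) / 2) ≤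
      volume {x ∈ Set.Ico a b | ∃ ξ ∈ R t, |x - ξ| < r t})
    (hdiv : ¬ Summable (T.indicator fun t => s t / r t)) :
    ∃ L ⊆ Set.Icc a b, MeasurableSet L ∧ ENNReal.ofReal ((b - a) / 112) ≤ volume L ∧
      ∀ y ∈ L, ∀ n, ∃ t ≥ n, ∃ ξ ∈ R t, |y - ξ| < s t := by
  classical
  choose! X ξ hX hcard using fun t ht => exists_grid_centres (hr t) (hvol t ht)
  set V : ℕ → Set ℝ := fun t => ⋃ k ∈ X t, Metric.ball (ξ t k) (s t) with hV
  set U : ℕ → Set ℝ := fun n => ⋃ t ∈ {t | t ∈ T ∧ n ≤ t}, V t with hU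
  have hVsub : ∀ t ∈ T, ∀ y ∈ V t, a - 3 * r t ≤ y ∧ y ≤ b + 3 * r t := by
    intro t ht y hy
    obtain ⟨k, hk, hy⟩ := Set.mem_iUnion₂.1 hy
    obtain ⟨-, h1, h2⟩ := hX t ht k hk
    rw [Nat.lt_ceil, lt_div_iff₀ (hr t)] at h2
    rw [Metric.mem_ball, Real.dist_eq] at hy
    have h3 := abs_lt.1 h1
    have h4 := abs_lt.1 hy
    have h5 := hsr t
    have h6 : 0 ≤ (k : ℝ) * r t := by have := hr t; positivity
    constructor <;> linarith [h3.1, h3.2, h4.1, h4.2]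
  have hUopen : ∀ n, IsOpen (U n) := fun n =>
    isOpen_biUnion fun t _ => isOpen_biUnion fun k _ => Metric.isOpen_ball
  have hUanti : Antitone U := fun m n hmn =>
    Set.biUnion_subset_biUnion_left fun t ht => ⟨ht.1, hmn.trans ht.2⟩
  have hUbdd : U 0 ⊆ Set.Icc (a - 3 * (b - a)) (b + 3 * (b - a)) := by
    intro y hy
    obtain ⟨t, ht, hy⟩ := Set.mem_iUnion₂.1 hy
    have h1 := hVsub t ht.1 y hy
    have h2 := hrb t ht.1
    constructor <;> linarith [h1.1, h1.2]
  have hUfin : ∀ n, volume (U n) ≠ ⊤ := fun n => measure_ne_top_of_subset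
    ((hUanti n.zero_le).trans hUbdd) (by rw [Real.volume_Icc]; exact ENNReal.ofReal_ne_top)
  have hnn : ∀ t, 0 ≤ T.indicator (fun t => s t / r t) t := fun t =>
    Set.indicator_nonneg (fun t _ => (div_pos (hs t) (hr t)).le) t
  have hUlarge : ∀ n, ENNReal.ofReal ((b - a) / 112) ≤ volume (U n) := by
    intro n
    rw [not_summable_iff_tendsto_nat_atTop_of_nonneg hnn] at hdiv
    obtain ⟨N, hN, hnN⟩ := ((hdiv.eventually_ge_atTop
      (1 + ∑ t ∈ Finset.range n, T.indicator (fun t => s t / r t) t)).and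
      (eventually_ge_atTop n)).exists
    set F := (Finset.Ico n N).filter (· ∈ T) with hF
    have hFT : ∀ t ∈ F, t ∈ T := fun t ht => (Finset.mem_filter.1 ht).2
    have hW : 1 ≤ ∑ t ∈ F, s t / r t := by
      rw [hF, Finset.sum_filter]
      have e := Finset.sum_range_add_sum_Ico (T.indicator fun t => s t / r t) hnN
      have e2 : ∑ t ∈ Finset.Ico n N, (if t ∈ T then s t / r t else 0) =
          ∑ t ∈ Finset.Ico n N, T.indicator (fun t => s t / r t) t :=
        Finset.sum_congr rfl fun t _ => by simp [Set.indicator_apply]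
      rw [e2]
      linarith
    have main := le_measureReal_biUnion_ball hab (fun t _ => hr t) (fun t ht => hrb t (hFT t ht))
      hs hhalf (fun t ht k hk => (hX t (hFT t ht) k hk).2) (fun t ht => hcard t (hFT t ht)) hW
    have hsub : (⋃ t ∈ F, ⋃ k ∈ X t, Metric.ball (ξ t k) (s t)) ⊆ U n :=
      Set.biUnion_subset_biUnion_left fun t ht =>
        ⟨hFT t ht, (Finset.mem_Ico.1 (Finset.mem_filter.1 ht).1).1⟩
    rw [ENNReal.ofReal_le_iff_le_toReal (hUfin n)]
    exact main.trans (measureReal_mono hsub (hUfin n))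
  refine ⟨⋂ n, U n, ?_, MeasurableSet.iInter fun n => (hUopen n).measurableSet, ?_, ?_⟩
  · intro y hy
    rw [Set.mem_iInter] at hy
    have key : ∀ ε > 0, a ≤ y + ε ∧ y ≤ b + ε := by
      intro ε hε
      obtain ⟨n, hn⟩ := hr0 (ε / 3) (by positivity)
      obtain ⟨t, ht, hyt⟩ := Set.mem_iUnion₂.1 (hy n)
      have h1 := hVsub t ht.1 y hyt
      have h2 := hn t ht.1 ht.2
      constructor <;> linarith [h1.1, h1.2]
    exact ⟨le_of_forall_pos_le_add fun ε hε => (key ε hε).1,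
      le_of_forall_pos_le_add fun ε hε => (key ε hε).2⟩
  · exact ge_of_tendsto' (tendsto_measure_iInter_atTop
      (fun n => (hUopen n).measurableSet.nullMeasurableSet) hUanti ⟨0, hUfin 0⟩) hUlarge
  · intro y hy n
    obtain ⟨t, ht, hyt⟩ := Set.mem_iUnion₂.1 (Set.mem_iInter.1 hy n)
    obtain ⟨k, hk, hyk⟩ := Set.mem_iUnion₂.1 hyt
    refine ⟨t, ht.2, ξ t k, (hX t ht.1 k hk).1, ?_⟩
    rwa [Metric.mem_ball, Real.dist_eq] at hyk

/-- The values of an approximating function along powers of two, truncated at the square root of the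
reciprocal. -/
noncomputable def dyadicTrunc (ψ : ℝ → ℝ) (t : ℕ) : ℝ := min (ψ (2 ^ t)) ((√2 ^ t)⁻¹)

lemma IsApproxFun.dyadicTrunc_pos {ψ : ℝ → ℝ} (hψ : IsApproxFun ψ) (t : ℕ) :
    0 < dyadicTrunc ψ t :=
  lt_min (hψ.2 _ (by positivity)) (by positivity)

lemma dyadicTrunc_le_one (ψ : ℝ → ℝ) (t : ℕ) : dyadicTrunc ψ t ≤ 1 :=
  (min_le_right _ _).trans
    (inv_le_one_of_one_le₀ (one_le_pow₀ (by rw [Real.one_le_sqrt]; norm_num)))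

lemma IsApproxFun.dyadicTrunc_succ_le {ψ : ℝ → ℝ} (hψ : IsApproxFun ψ) (t : ℕ) :
    dyadicTrunc ψ (t + 1) ≤ dyadicTrunc ψ t :=
  min_le_min
    (hψ.1 _ _ (by positivity) (pow_le_pow_right₀ (by norm_num) (Nat.le_succ t)))
    (inv_anti₀ (by positivity)
      (pow_le_pow_right₀ (by rw [Real.one_le_sqrt]; norm_num) (Nat.le_succ t)))

lemma IsApproxFun.dyadicTrunc_sq_mul {ψ : ℝ → ℝ} (hψ : IsApproxFun ψ) (t : ℕ) :
    dyadicTrunc ψ t ^ 2 * 2 ^ t = min (2 ^ t * ψ (2 ^ t) ^ 2) 1 := by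
  have h1 : ((√2 ^ t)⁻¹) ^ 2 * (2 : ℝ) ^ t = 1 := by
    rw [inv_pow, ← pow_mul, mul_comm t 2, pow_mul, Real.sq_sqrt (by norm_num)]
    exact inv_mul_cancel₀ (by positivity)
  have hp : 0 < ψ (2 ^ t) := hψ.2 _ (by positivity)
  have h2 : (0 : ℝ) < (√2 ^ t)⁻¹ := by positivity
  have h3 : (0 : ℝ) < 2 ^ t := by positivity
  rw [dyadicTrunc]
  rcases le_total (ψ (2 ^ t)) ((√2 ^ t)⁻¹) with h | h
  · have : 2 ^ t * ψ (2 ^ t) ^ 2 ≤ 1 := by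
      rw [mul_comm, ← h1]
      gcongr
    rw [min_eq_left h, min_eq_left this, mul_comm]
  · have : 1 ≤ 2 ^ t * ψ (2 ^ t) ^ 2 := by
      rw [mul_comm, ← h1]
      gcongr
    rw [min_eq_right h, min_eq_right this, h1]

lemma not_summable_min_one {c : ℕ → ℝ} (hc : ¬ Summable c) :
    ¬ Summable fun t => min (c t) 1 := by
  intro h
  refine hc ?_
  have h1 : ∀ᶠ t in atTop, min (c t) 1 < 1 := h.tendsto_atTop_zero.eventually_lt_const one_pos
  obtain ⟨N, hN⟩ := eventually_atTop.1 h1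
  rw [← summable_nat_add_iff N] at h ⊢
  refine h.congr fun t => ?_
  have := hN (t + N) (Nat.le_add_left _ _)
  exact min_eq_left (by by_contra! hlt; rw [min_eq_right hlt.le] at this; exact lt_irrefl _ this)

lemma IsApproxFun.not_summable_dyadicTrunc {ψ : ℝ → ℝ} (hψ : IsApproxFun ψ)
    (hdiv : ¬ Summable (fun h : ℕ => ψ h ^ 2)) :
    ¬ Summable fun t => dyadicTrunc ψ t ^ 2 * 2 ^ t := by
  simp_rw [hψ.dyadicTrunc_sq_mul]
  refine not_summable_min_one fun h => hdiv ?_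
  refine (summable_condensed_iff_of_nonneg (f := fun h : ℕ => ψ h ^ 2) (fun n => sq_nonneg _)
    fun m n hm hmn => ?_).1 (by exact_mod_cast h)
  have hm' : (0 : ℝ) < m := by exact_mod_cast hm
  have hn' : (m : ℝ) ≤ n := by exact_mod_cast hmn
  exact pow_le_pow_left₀ (hψ.2 _ (hm'.trans_le hn')).le (hψ.1 _ _ hm' hn') 2

lemma IsApproxFun.not_summable_indicator {ψ : ℝ → ℝ} (hψ : IsApproxFun ψ)
    (hdiv : ¬ Summable (fun h : ℕ => ψ h ^ 2)) (t₀ : ℕ) :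
    ¬ Summable ({t | t₀ ≤ t ∧ (3 / 5 : ℝ) ^ t ≤ dyadicTrunc ψ t}.indicator
      fun t => dyadicTrunc ψ t ^ 2 * 2 ^ t) := by
  classical
  set T : Set ℕ := {t | t₀ ≤ t ∧ (3 / 5 : ℝ) ^ t ≤ dyadicTrunc ψ t}
  intro h
  refine hψ.not_summable_dyadicTrunc hdiv ?_
  have hg : Summable fun t : ℕ => (18 / 25 : ℝ) ^ t :=
    summable_geometric_of_lt_one (by norm_num) (by norm_num)
  have hsum := h.add hg
  rw [← summable_nat_add_iff t₀] at hsum ⊢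
  refine Summable.of_nonneg_of_le (fun t => by positivity) (fun t => ?_) hsum
  set n := t + t₀
  by_cases hn : (3 / 5 : ℝ) ^ n ≤ dyadicTrunc ψ n
  · rw [Set.indicator_of_mem (show n ∈ T from ⟨Nat.le_add_left _ _, hn⟩)]
    have : (0 : ℝ) ≤ (18 / 25) ^ n := by positivity
    linarith
  · rw [Set.indicator_of_notMem (show n ∉ T from fun hmem => hn hmem.2), zero_add]
    have h0 := hψ.dyadicTrunc_pos n
    calc dyadicTrunc ψ n ^ 2 * 2 ^ n ≤ ((3 / 5 : ℝ) ^ n) ^ 2 * 2 ^ n := by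
          gcongr; exact (not_le.1 hn).le
      _ = (18 / 25) ^ n := by rw [← pow_mul, mul_comm n 2, pow_mul, ← mul_pow]; norm_num

/-- A point of the curve close to a rational point close to the curve is well approximable. -/
lemma CurveOn.distNearestInt_lt {f f₁ f₂ : ℝ → ℝ} {u v K δ y M : ℝ} {q p₁ p₂ : ℤ}
    (H : CurveOn f f₁ f₂ u v K) (hδ : 0 < δ) (hq : (0 : ℝ) < q) (hqM : q ≤ M)
    (hy : y ∈ Set.Icc u v) (hp : (p₁ / q : ℝ) ∈ Set.Icc u v)
    (hclose : |y - p₁ / q| < δ / M / (4 * K)) (hf : |q * f (p₁ / q) - p₂| ≤ δ / 4) :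
    max (distNearestInt (q * y)) (distNearestInt (q * f y)) < δ := by
  have hK := H.one_le
  have hM : 0 < M := hq.trans_le hqM
  have h1 : q * |y - p₁ / q| ≤ δ / (4 * K) := by
    calc q * |y - p₁ / q| ≤ M * (δ / M / (4 * K)) := by gcongr
      _ = δ / (4 * K) := by field_simp
  have h2 : δ / (4 * K) ≤ δ / 4 := by gcongr; linarith
  refine max_lt ?_ ?_
  · refine (round_le _ p₁).trans_lt ?_
    have e : (q : ℝ) * y - p₁ = q * (y - p₁ / q) := by field_simp
    rw [e, abs_mul, abs_of_pos hq]
    linarith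
  · refine (round_le _ p₂).trans_lt ?_
    have e : (q : ℝ) * f y - p₂ = q * (f y - f (p₁ / q)) + (q * f (p₁ / q) - p₂) := by ring
    have h3 : |(q : ℝ) * (f y - f (p₁ / q))| ≤ δ / 4 := by
      rw [abs_mul, abs_of_pos hq]
      calc q * |f y - f (p₁ / q)| ≤ q * (K * |y - p₁ / q|) := by
            gcongr; exact H.abs_sub_le hy hp
        _ = K * (q * |y - p₁ / q|) := by ring
        _ ≤ K * (δ / (4 * K)) := by gcongr
        _ = δ / 4 := by field_simp
    rw [e]
    refine (abs_add_le _ _).trans_lt ?_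
    linarith

/-- Approximable points fill a fixed proportion of every interior interval. -/
theorem CurveOn.exists_large_subset {f f₁ f₂ : ℝ → ℝ} {u v a b K : ℝ} {ψ : ℝ → ℝ}
    (H : CurveOn f f₁ f₂ u v K) (hψ : IsApproxFun ψ) (hdiv : ¬ Summable (fun h : ℕ => ψ h ^ 2))
    (hua : u < a) (hab : a < b) (hbv : b < v) :
    ∃ L ⊆ Set.Icc a b, MeasurableSet L ∧ ENNReal.ofReal ((b - a) / 112) ≤ volume L ∧
      ∀ y ∈ L, (y, f y) ∈ SimApprox2 ψ := by
  have hK := H.one_le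
  obtain ⟨κ, Q₀, hκ, hκ8, hvol⟩ := H.exists_volume_nearRational_ge hua hab hbv
  set δ := dyadicTrunc ψ with hδdef
  have hδ : ∀ t, 0 < δ t := hψ.dyadicTrunc_pos
  set Q : ℕ → ℝ := fun t => κ ^ 2 * 2 ^ t / 4 with hQdef
  have hQ : ∀ t, 0 < Q t := fun t => by positivity
  set r : ℕ → ℝ := fun t => (δ t * Q t ^ 2)⁻¹ with hrdef
  have hr : ∀ t, 0 < r t := fun t => by have := hδ t; have := hQ t; positivity
  set s : ℕ → ℝ := fun t => δ t / 2 ^ t / (4 * K) with hsdef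
  have hs : ∀ t, 0 < s t := fun t => by have := hδ t; positivity
  have hsr_eq : ∀ t, s t / r t = κ ^ 4 / (64 * K) * (δ t ^ 2 * 2 ^ t) := by
    intro t
    have := hδ t
    simp only [hsdef, hrdef, hQdef]
    field_simp
    norm_num
  have hgeo : ∀ (q c : ℝ), 0 < c → 1 < q → ∀ M : ℝ, ∃ n, ∀ t ≥ n, M < c * q ^ t := by
    intro q c hc hq M
    exact eventually_atTop.1
      (((tendsto_pow_atTop_atTop_of_one_lt hq).const_mul_atTop hc).eventually_gt_atTop M)
  obtain ⟨n₁, hn₁⟩ := hgeo (12 / 5) (κ ^ 4 / 16) (by positivity) (by norm_num) (b - a)⁻¹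
  obtain ⟨n₂, hn₂⟩ := hgeo (6 / 5) (κ ^ 2 / 4) (by positivity) (by norm_num) Q₀
  set T : Set ℕ := {t | max n₁ n₂ ≤ t ∧ (3 / 5 : ℝ) ^ t ≤ δ t} with hT
  have hlow : ∀ t ∈ T, κ ^ 4 / 16 * (12 / 5) ^ t ≤ δ t * Q t ^ 2 := by
    intro t ht
    calc κ ^ 4 / 16 * (12 / 5 : ℝ) ^ t = (3 / 5) ^ t * Q t ^ 2 := by
          have : (12 / 5 : ℝ) ^ t = (3 / 5) ^ t * (2 ^ t) ^ 2 := by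
            rw [← pow_mul, mul_comm t 2, pow_mul, ← mul_pow]; norm_num
          rw [this]; simp only [hQdef]; ring
      _ ≤ δ t * Q t ^ 2 := by gcongr; exact ht.2
  have hlow2 : ∀ t ∈ T, Q₀ ≤ δ t * Q t := by
    intro t ht
    refine (hn₂ t (le_of_max_le_right ht.1)).le.trans ?_
    calc κ ^ 2 / 4 * (6 / 5 : ℝ) ^ t = (3 / 5) ^ t * Q t := by
          have : (6 / 5 : ℝ) ^ t = (3 / 5) ^ t * 2 ^ t := by rw [← mul_pow]; norm_num
          rw [this]; simp only [hQdef]; ring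
      _ ≤ δ t * Q t := by exact mul_le_mul_of_nonneg_right ht.2 (hQ t).le
  set R : ℕ → Set ℝ := fun t => {ξ | ∃ q p₁ p₂ : ℤ, κ * Q t ≤ q ∧ (q : ℝ) ≤ 2 ^ t ∧
    ξ = p₁ / q ∧ ξ ∈ Set.Icc u v ∧ |q * f ξ - p₂| ≤ δ t / 4} with hR
  suffices main : ∃ L ⊆ Set.Icc a b, MeasurableSet L ∧ ENNReal.ofReal ((b - a) / 112) ≤ volume L ∧
      ∀ y ∈ L, ∀ n, ∃ t ≥ n, ∃ ξ ∈ R t, |y - ξ| < s t by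
    obtain ⟨L, hLsub, hLm, hLvol, hL⟩ := main
    refine ⟨L, hLsub, hLm, hLvol, fun y hy => Set.infinite_of_forall_exists_gt fun N => ?_⟩
    obtain ⟨n, hn⟩ := hgeo 2 (κ * (κ ^ 2 / 4)) (by positivity) (by norm_num) N
    obtain ⟨t, ht, ξ, ⟨q, p₁, p₂, hqlo, hqhi, rfl, hξ, hfξ⟩, hyξ⟩ := hL y hy n
    have hNq : (N : ℝ) < q := by
      refine ((hn t ht).trans_le ?_).trans_le hqlo
      simp only [hQdef]
      exact le_of_eq (by ring)
    have hq0 : (0 : ℝ) < q := (Nat.cast_nonneg N).trans_lt hNq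
    lift q to ℕ using by exact_mod_cast hq0.le
    have hyI := hLsub hy
    have hlt := H.distNearestInt_lt (hδ t) hq0 hqhi ⟨by linarith [hyI.1], by linarith [hyI.2]⟩ hξ
      hyξ hfξ
    simp only [Int.cast_natCast] at hlt hq0 hqhi hNq
    refine ⟨q, ⟨by exact_mod_cast hq0, hlt.trans_le ?_⟩, by exact_mod_cast hNq⟩
    exact (min_le_left _ _).trans (hψ.1 _ _ hq0 hqhi)
  refine exists_limsup_set (T := T) hab hr hs ?_ ?_ ?_ ?_ ?_ ?_
  · intro t
    have h1 := hψ.dyadicTrunc_succ_le t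
    simp only [hsdef]
    calc δ (t + 1) / 2 ^ (t + 1) / (4 * K) ≤ δ t / 2 ^ (t + 1) / (4 * K) := by gcongr
      _ = δ t / 2 ^ t / (4 * K) / 2 := by rw [pow_succ]; field_simp
  · intro t
    rw [← div_le_one (hr t), hsr_eq]
    have h1 : δ t ^ 2 * 2 ^ t ≤ 1 := (hψ.dyadicTrunc_sq_mul t).trans_le (min_le_right _ _)
    have h2 : κ ^ 4 / (64 * K) ≤ 1 := by
      rw [div_le_one (by positivity)]
      have : κ ^ 4 ≤ 1 := pow_le_one₀ hκ.le (by linarith)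
      linarith
    have h3 : 0 ≤ δ t ^ 2 * 2 ^ t := by positivity
    have h4 : 0 ≤ κ ^ 4 / (64 * K) := by positivity
    nlinarith
  · intro t ht
    rw [hrdef, inv_le_comm₀ (by have := hδ t; have := hQ t; positivity) (by linarith)]
    exact (hn₁ t (le_of_max_le_left ht.1)).le.trans (hlow t ht)
  · intro ε hε
    obtain ⟨n, hn⟩ := hgeo (12 / 5) (κ ^ 4 / 16) (by positivity) (by norm_num) ε⁻¹
    refine ⟨n, fun t ht hnt => ?_⟩
    rw [hrdef, inv_lt_comm₀ (by have := hδ t; have := hQ t; positivity) hε]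
    exact (hn t hnt).trans_le (hlow t ht)
  · intro t ht
    refine (hvol (Q t) (δ t) (hδ t) (dyadicTrunc_le_one ψ t) (hlow2 t ht)).trans
      (measure_mono ?_)
    rintro x ⟨hx, q, p₁, p₂, h1, h2, h3, h4, h5⟩
    refine ⟨hx, p₁ / q, ⟨q, p₁, p₂, h1, h2.trans_eq ?_, rfl, h3, h5.trans ?_⟩, h4⟩
    · simp only [hQdef]; field_simp
    · have := hδ t
      nlinarith
  · simp_rw [hsr_eq]
    intro hsum
    refine hψ.not_summable_indicator hdiv (max n₁ n₂) ?_
    have hc : κ ^ 4 / (64 * K) ≠ 0 := by positivity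
    rw [← summable_mul_left_iff hc]
    refine hsum.congr fun t => ?_
    by_cases ht : t ∈ T
    · rw [Set.indicator_of_mem ht, Set.indicator_of_mem ht]
    · rw [Set.indicator_of_notMem ht, Set.indicator_of_notMem ht, mul_zero]

lemma CurveOn.volume_notMem_simApprox2 {f f₁ f₂ ψ : ℝ → ℝ} {u v K : ℝ}
    (H : CurveOn f f₁ f₂ u v K) (hψ : IsApproxFun ψ)
    (hdiv : ¬ Summable (fun h : ℕ => ψ h ^ 2)) :
    volume {x ∈ Set.Ioo u v | (x, f x) ∉ SimApprox2 ψ} = 0 := by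
  set Z := {x ∈ Set.Ioo u v | (x, f x) ∉ SimApprox2 ψ} with hZ
  rw [← Measure.restrict_eq_zero, ← ae_eq_bot, ← Filter.eventually_false_iff_eq_bot]
  have hmem : ∀ᵐ x ∂volume.restrict Z, x ∈ Set.Ioo u v :=
    ae_mono (Measure.restrict_mono (fun x hx => hx.1) le_rfl) (ae_restrict_mem measurableSet_Ioo)
  filter_upwards [Besicovitch.ae_tendsto_measure_inter_div volume Z, hmem] with x hx hxI
  have hsmall : ∀ᶠ r in nhdsWithin (0 : ℝ) (Set.Ioi 0),
      volume (Z ∩ Metric.closedBall x r) / volume (Metric.closedBall x r)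
        ≤ ENNReal.ofReal (111 / 112) := by
    have hpos : 0 < min (x - u) (v - x) := lt_min (sub_pos.2 hxI.1) (sub_pos.2 hxI.2)
    filter_upwards [Ioo_mem_nhdsGT hpos] with r hr
    obtain ⟨h0, hr⟩ := hr
    obtain ⟨h1, h2⟩ := lt_min_iff.1 hr
    obtain ⟨L, hLs, hLm, hLv, hL⟩ := H.exists_large_subset hψ hdiv (a := x - r) (b := x + r)
      (by linarith) (by linarith) (by linarith)
    have hdisj : Disjoint (Z ∩ Metric.closedBall x r) L :=
      Set.disjoint_left.2 fun y hy hyL => hy.1.2 (hL y hyL)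
    have hun := measure_union (μ := volume) hdisj hLm
    have hle : volume (Z ∩ Metric.closedBall x r ∪ L) ≤ ENNReal.ofReal (2 * r) := by
      rw [← Real.volume_closedBall (a := x)]
      refine measure_mono (Set.union_subset Set.inter_subset_right ?_)
      rwa [Real.closedBall_eq_Icc]
    rw [Real.volume_closedBall]
    refine ENNReal.div_le_of_le_mul ?_
    rw [← ENNReal.ofReal_mul (by norm_num)]
    have hadd : volume (Z ∩ Metric.closedBall x r) + ENNReal.ofReal (2 * r / 112)
        ≤ ENNReal.ofReal (111 / 112 * (2 * r)) + ENNReal.ofReal (2 * r / 112) := by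
      rw [← ENNReal.ofReal_add (by positivity) (by positivity)]
      calc _ ≤ volume (Z ∩ Metric.closedBall x r) + volume L := by
            refine add_le_add_right (le_trans (le_of_eq ?_) hLv) _
            congr 1
            ring
        _ ≤ _ := by
            rw [← hun]
            convert hle using 2
            ring
    exact (ENNReal.add_le_add_iff_right ENNReal.ofReal_ne_top).1 hadd
  have := le_of_tendsto hx hsmall
  rw [← ENNReal.ofReal_one, ENNReal.ofReal_le_ofReal_iff (by norm_num)] at this
  norm_num at this

lemma ContDiffAt.exists_curveOn {f : ℝ → ℝ} {x : ℝ} (hf : ContDiffAt ℝ 3 f x)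
    (hx : deriv (deriv f) x ≠ 0) :
    ∃ u v K : ℝ, x ∈ Set.Ioo u v ∧ CurveOn f (deriv f) (deriv (deriv f)) u v K := by
  have hf₁ : ContDiffAt ℝ 2 (deriv f) x := hf.derivWithin (by norm_num)
  have hf₂ : ContDiffAt ℝ 1 (deriv (deriv f)) x := hf₁.derivWithin (by norm_num)
  have hpos : 0 < |deriv (deriv f) x| := abs_pos.2 hx
  set K := max (max 1 (|deriv f x| + 1))
    (max (|deriv (deriv f) x| + 1) (|deriv (deriv f) x| / 2)⁻¹) with hK
  have hev : ∀ᶠ y in nhds x, ContDiffAt ℝ 3 f y ∧ ContDiffAt ℝ 2 (deriv f) y ∧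
      |deriv f y| < |deriv f x| + 1 ∧ |deriv (deriv f) x| / 2 < |deriv (deriv f) y| ∧
      |deriv (deriv f) y| < |deriv (deriv f) x| + 1 :=
    (hf.eventually (by decide)).and <| (hf₁.eventually (by decide)).and <|
      (hf₁.continuousAt.abs.eventually_lt_const (lt_add_one _)).and <|
      (hf₂.continuousAt.abs.eventually_const_lt (half_lt_self hpos)).and <|
      hf₂.continuousAt.abs.eventually_lt_const (lt_add_one _)
  obtain ⟨ε, hε, h⟩ := Metric.eventually_nhds_iff_ball.1 hev
  have hsub : Set.Icc (x - ε / 2) (x + ε / 2) ⊆ Metric.ball x ε := by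
    rw [← Real.closedBall_eq_Icc]
    exact Metric.closedBall_subset_ball (half_lt_self hε)
  refine ⟨x - ε / 2, x + ε / 2, K, ⟨by linarith, by linarith⟩, ?_, ?_, ?_, ?_, ?_, ?_⟩
  · exact (le_max_left _ _).trans (le_max_left _ _)
  · exact fun y hy => ((h y (hsub hy)).1.differentiableAt (by norm_num)).hasDerivAt
  · exact fun y hy => ((h y (hsub hy)).2.1.differentiableAt (by norm_num)).hasDerivAt
  · exact fun y hy => (h y (hsub hy)).2.2.1.le.trans
      ((le_max_right _ _).trans (le_max_left _ _))
  · exact fun y hy => (inv_le_of_inv_le₀ (half_pos hpos)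
      ((le_max_right _ _).trans (le_max_right _ _))).trans (h y (hsub hy)).2.2.2.1.le
  · exact fun y hy => (h y (hsub hy)).2.2.2.2.le.trans
      ((le_max_left _ _).trans (le_max_right _ _))

theorem khintchine_divergence_on_curve
    (ψ : ℝ → ℝ) (hψ : IsApproxFun ψ)
    (hdiv : ¬ Summable (fun h : ℕ => ψ h ^ 2))
    (I₀ : Set ℝ) (hI₀ : I₀.OrdConnected)
    (f : ℝ → ℝ) (hf : ContDiffOn ℝ 3 f I₀)
    (hf'' : ∀ᵐ x ∂(volume.restrict I₀), iteratedDerivWithin 2 f I₀ x ≠ 0) :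
    ∀ᵐ x ∂(volume.restrict I₀), (x, f x) ∈ SimApprox2 ψ := by
  have hnull : volume {x ∈ interior I₀ |
      iteratedDerivWithin 2 f I₀ x ≠ 0 ∧ (x, f x) ∉ SimApprox2 ψ} = 0 := by
    refine measure_null_of_locally_null _ fun x hx => ?_
    have hfx : ContDiffAt ℝ 3 f x := hf.contDiffAt (mem_interior_iff_mem_nhds.1 hx.1)
    have hx₂ : deriv (deriv f) x ≠ 0 := by
      have := hx.2.1
      rwa [iteratedDerivWithin_eq_iteratedDeriv
        (uniqueDiffOn_convex hI₀.convex ⟨x, hx.1⟩) (hfx.of_le (by norm_num))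
        (interior_subset hx.1), iteratedDeriv_succ, iteratedDeriv_one] at this
    obtain ⟨u, v, K, hxuv, H⟩ := hfx.exists_curveOn hx₂
    refine ⟨_, ?_, H.volume_notMem_simApprox2 hψ hdiv⟩
    filter_upwards [self_mem_nhdsWithin, mem_nhdsWithin_of_mem_nhds (Ioo_mem_nhds hxuv.1 hxuv.2)]
      with y hy hyI using ⟨hyI, hy.2.2⟩
  have hfrontier : ∀ᵐ x ∂volume, x ∉ frontier I₀ :=
    measure_eq_zero_iff_ae_notMem.1 (hI₀.convex.addHaar_frontier volume)
  rw [ae_restrict_iff' hI₀.measurableSet] at hf'' ⊢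
  filter_upwards [hf'', hfrontier, measure_eq_zero_iff_ae_notMem.1 hnull] with x h₁ h₂ h₃ hxI
  have hxint : x ∈ interior I₀ := by
    by_contra h
    exact h₂ ⟨subset_closure hxI, h⟩
  by_contra h
  exact h₃ ⟨hxint, h₁ hxI, h⟩
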